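/- Let G be a finite graph. Then NC*(G) is connected if and only if G is of one of the following forms: (A) an arc; (B) a tangle; (C) the union K ∪ J of a tangle K and an arc J meeting in a single point which is an endpoint of J; (D) the union of two tangles meeting in a single point; (E) the union K ∪ pq ∪ M of two disjoint tangles K, M and an arc pq with K ∩ pq = {p} and M ∩ pq = {q}. -/

import Mathlib

open TopologicalSpace Set

/-- A finite graph: a space which is a finite union of arcs, any two of which meet
in a finite set. -/
def IsFiniteGraph (G : Type*) [TopologicalSpace G] : Prop :=
  ∃ 𝒜 : Finset (Set G),
    (⋃ A ∈ 𝒜, A) = Set.univ ∧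
    (∀ A ∈ 𝒜, Nonempty (unitInterval ≃ₜ A)) ∧
    (∀ A ∈ 𝒜, ∀ B ∈ 𝒜, A ≠ B → (A ∩ B).Finite)

/-- A tangle: a finite graph without cut-points. -/
def IsTangle (G : Type*) [TopologicalSpace G] : Prop :=
  IsFiniteGraph G ∧ ∀ p : G, IsPreconnected ({p}ᶜ : Set G)

/-- The hyperspace NC*(G). -/
abbrev NCstar (X : Type*) [MetricSpace X] :=
  {A : NonemptyCompacts X // IsConnected (A : Set X) ∧ IsPreconnected ((A : Set X)ᶜ)}

namespace FiniteGraphHyperspace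

section Connectedness

variable {G : Type*} [TopologicalSpace G]

theorem isPreconnected_inter_of_inter_eq_singleton {S X Y : Set G} {p : G} (hX : IsClosed X)
    (hY : IsClosed Y) (hXY : X ∩ Y = {p}) (hS : IsPreconnected S) (hSXY : S ⊆ X ∪ Y) :
    IsPreconnected (S ∩ X) := by
  have hp : p ∈ X ∩ Y := hXY ▸ mem_singleton p
  have hmem : ∀ x, x ∈ X → x ∈ Y → x = p := fun x h1 h2 => by
    have : x ∈ X ∩ Y := ⟨h1, h2⟩
    rwa [hXY] at this
  rw [isPreconnected_closed_iff] at hS ⊢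
  by_cases hpS : p ∈ S
  · have key : ∀ t t' : Set G, IsClosed t → IsClosed t' → S ∩ X ⊆ t ∪ t' → p ∈ t →
        ((S ∩ X) ∩ t').Nonempty → ((S ∩ X) ∩ (t ∩ t')).Nonempty := by
      rintro t t' ht ht' hc hpt ⟨y, hy, hyt⟩
      obtain ⟨z, hzS, hz1, hz2⟩ := hS ((t ∩ X) ∪ Y) (t' ∩ X) ((ht.inter hX).union hY)
        (ht'.inter hX) (by
          intro z hz
          rcases hSXY hz with h | h
          · rcases hc ⟨hz, h⟩ with h' | h'
            · exact Or.inl (Or.inl ⟨h', h⟩)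
            · exact Or.inr ⟨h', h⟩
          · exact Or.inl (Or.inr h)) ⟨p, hpS, Or.inr hp.2⟩ ⟨y, hy.1, hyt, hy.2⟩
      rcases hz1 with h | h
      · exact ⟨z, ⟨hzS, h.2⟩, h.1, hz2.1⟩
      · obtain rfl := hmem z hz2.2 h
        exact ⟨z, ⟨hzS, hz2.2⟩, hpt, hz2.1⟩
    intro t t' ht ht' hc h1 h2
    rcases hc ⟨hpS, hp.1⟩ with h | h
    · exact key t t' ht ht' hc h h2
    · rw [inter_comm t t']
      exact key t' t ht' ht (by rwa [union_comm]) h h1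
  · intro t t' ht ht' hc h1 h2
    have hSX : S ⊆ X := by
      intro y hy
      by_contra hyX
      obtain ⟨z, hz, hz1, hz2⟩ := hS X Y hX hY hSXY (h1.mono fun z hz => ⟨hz.1.1, hz.1.2⟩)
        ⟨y, hy, (hSXY hy).resolve_left hyX⟩
      exact hpS (hmem z hz1 hz2 ▸ hz)
    rw [inter_eq_left.2 hSX] at *
    exact hS t t' ht ht' hc h1 h2

theorem IsOpen.exists_separation {S : Set G} (hS : IsOpen S) (h : ¬ IsPreconnected S) :
    ∃ U V : Set G, IsOpen U ∧ IsOpen V ∧ Disjoint U V ∧ U.Nonempty ∧ V.Nonempty ∧ U ∪ V = S := by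
  rw [isPreconnected_iff_subset_of_disjoint] at h
  push Not at h
  obtain ⟨u, v, hu, hv, hc, hd, h1, h2⟩ := h
  obtain ⟨x, hx, hxu⟩ := not_subset.1 h1
  obtain ⟨y, hy, hyv⟩ := not_subset.1 h2
  refine ⟨S ∩ u, S ∩ v, hS.inter hu, hS.inter hv, ?_, ⟨y, hy, (hc hy).resolve_right hyv⟩,
    ⟨x, hx, (hc hx).resolve_left hxu⟩, ?_⟩
  · rw [disjoint_iff_inter_eq_empty, ← hd]
    ext z; simp only [mem_inter_iff]; tauto
  · rw [← inter_union_distrib_left, inter_eq_left.2 hc]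

/-- The open sets `U` and `V` separate the space at the point `p`. -/
structure Separates (p : G) (U V : Set G) : Prop where
  isOpen_left : IsOpen U
  isOpen_right : IsOpen V
  disjoint : Disjoint U V
  nonempty_left : U.Nonempty
  nonempty_right : V.Nonempty
  union_eq : U ∪ V = {p}ᶜ

namespace Separates

variable {p : G} {U V : Set G}

theorem symm (h : Separates p U V) : Separates p V U :=
  ⟨h.2, h.1, h.3.symm, h.5, h.4, by rw [union_comm, h.6]⟩

theorem notMem_left (h : Separates p U V) : p ∉ U := fun hp =>
  (h.union_eq.subset (Or.inl hp) : p ∈ ({p}ᶜ : Set G)) rfl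

theorem mem_or (h : Separates p U V) {x : G} (hx : x ≠ p) : x ∈ U ∨ x ∈ V :=
  h.union_eq.symm.subset hx

theorem compl_left (h : Separates p U V) : Uᶜ = insert p V := by
  ext x
  by_cases hx : x = p
  · subst hx; simp [h.notMem_left]
  · have := h.mem_or hx
    have : x ∈ U → x ∉ V := fun hx => disjoint_left.1 h.disjoint hx
    simp [hx]; tauto

theorem isClosed_insert (h : Separates p U V) : IsClosed (insert p V) := by
  rw [← h.compl_left]; exact h.isOpen_left.isClosed_compl

theorem inter_eq (h : Separates p U V) : insert p U ∩ insert p V = {p} := by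
  rw [← insert_inter_distrib, h.disjoint.inter_eq, insert_empty_eq]

theorem union_insert (h : Separates p U V) : insert p U ∪ insert p V = univ := by
  rw [← h.compl_left]
  ext x
  by_cases hx : x ∈ U <;> simp [hx]

theorem isConnected_insert [PreconnectedSpace G] (h : Separates p U V) :
    IsConnected (insert p V) := by
  refine ⟨⟨p, mem_insert _ _⟩, ?_⟩
  have := isPreconnected_inter_of_inter_eq_singleton h.isClosed_insert h.symm.isClosed_insert
    h.symm.inter_eq isPreconnected_univ (by rw [h.symm.union_insert])
  rwa [univ_inter] at this

theorem mem_closure [PreconnectedSpace G] [T1Space G] (h : Separates p U V) : p ∈ closure V := by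
  by_contra hp
  have hcl : IsClosed V := by
    refine isClosed_of_closure_subset fun x hx => ?_
    have hx' := closure_minimal (subset_insert p V) h.isClosed_insert hx
    exact hx'.resolve_left (by rintro rfl; exact hp hx)
  rcases isClopen_iff.1 ⟨hcl, h.isOpen_right⟩ with h' | h'
  · exact h.nonempty_right.ne_empty h'
  · exact h.symm.notMem_left (h' ▸ mem_univ p)

/-- If `x` separates `Y` from `v`, and `x` lies on the side `P` of `v`, then `Y ⊆ P`. -/
theorem insert_subset_of_mem [PreconnectedSpace G] {v x : G} {P D X Y : Set G}
    (h : Separates v P D) (hx : x ∈ P) (h' : Separates x X Y) (hv : v ∈ X) :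
    insert v D ⊆ X := by
  have hc := h.isConnected_insert.isPreconnected
  have hsub : insert v D ⊆ X ∪ Y := by
    rw [h'.union_eq, ← h.compl_left]
    intro z hz hzx
    exact hz (by rw [mem_singleton_iff.1 hzx]; exact hx)
  exact hc.subset_left_of_subset_union h'.isOpen_left h'.isOpen_right h'.disjoint hsub
    ⟨v, mem_insert _ _, hv⟩

theorem subset_of_mem [PreconnectedSpace G] {v x : G} {P D X Y : Set G}
    (h : Separates v P D) (hx : x ∈ P) (h' : Separates x X Y) (hv : v ∈ X) : Y ⊆ P := by
  intro y hy
  by_contra hyP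
  have : y ∈ insert v D := by rw [← h.compl_left]; exact hyP
  exact disjoint_left.1 h'.disjoint (h.insert_subset_of_mem hx h' hv this) hy

theorem not_isPreconnected (h : Separates p U V) : ¬ IsPreconnected ({p}ᶜ : Set G) := by
  intro hc
  rcases hc.subset_or_subset h.isOpen_left h.isOpen_right h.disjoint h.union_eq.symm.subset with
    h' | h'
  · obtain ⟨x, hx⟩ := h.nonempty_right
    exact disjoint_left.1 h.disjoint (h' (h.union_eq.subset (Or.inr hx))) hx
  · obtain ⟨x, hx⟩ := h.nonempty_left
    exact disjoint_left.1 h.disjoint hx (h' (h.union_eq.subset (Or.inl hx)))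

end Separates

theorem exists_separates_of_not_isPreconnected [T1Space G] {p : G}
    (h : ¬ IsPreconnected ({p}ᶜ : Set G)) (v : G) (hv : v ≠ p) :
    ∃ X Y, Separates p X Y ∧ v ∈ X := by
  obtain ⟨U, V, h1, h2, h3, h4, h5, h6⟩ := IsOpen.exists_separation isOpen_compl_singleton h
  have hs : Separates p U V := ⟨h1, h2, h3, h4, h5, h6⟩
  rcases hs.mem_or hv with h' | h'
  exacts [⟨U, V, hs, h'⟩, ⟨V, U, hs.symm, h'⟩]

end Connectedness

section Cells

/-- A union of cells. -/
def IsCellular.Aligned {G : Type*} (ℰ : Set (Set G)) (W : Set G) : Prop :=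
  ∀ e ∈ ℰ, (e ∩ W).Nonempty → e ⊆ W

theorem IsCellular.Aligned.compl {G : Type*} {ℰ : Set (Set G)} {W : Set G}
    (h : IsCellular.Aligned ℰ W) : IsCellular.Aligned ℰ Wᶜ := by
  rintro e he ⟨x, hx, hxW⟩ y hy hyW
  exact hxW (h e he ⟨y, hy, hyW⟩ hx)

variable {G : Type*} [TopologicalSpace G]

/-- The set `e` is an open edge with distinct endpoints `x` and `y`. -/
structure IsEdge (e : Set G) (x y : G) : Prop where
  isOpen : IsOpen e
  exists_path : ∃ g : C(unitInterval, G), Function.Injective g ∧ g 0 = x ∧ g 1 = y ∧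
    g '' Ioo 0 1 = e

theorem Icc_eq_insert_Ioo : (univ : Set unitInterval) = insert 0 (insert 1 (Ioo 0 1)) := by
  ext t
  simp only [mem_univ, mem_insert_iff, mem_Ioo, true_iff]
  by_cases h0 : t = 0
  · exact Or.inl h0
  · by_cases h1 : t = 1
    · exact Or.inr (Or.inl h1)
    · exact Or.inr (Or.inr ⟨unitInterval.pos_iff_ne_zero.2 h0, unitInterval.lt_one_iff_ne_one.2 h1⟩)

namespace IsEdge

variable {e : Set G} {x y : G}

theorem symm (h : IsEdge e x y) : IsEdge e y x := by
  obtain ⟨g, hg, h0, h1, he⟩ := h.exists_path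
  refine ⟨h.isOpen, g.comp ⟨unitInterval.symm, by fun_prop⟩,
    hg.comp unitInterval.symm_bijective.injective, by simpa, by simpa, ?_⟩
  rw [← he]
  ext z
  constructor
  · rintro ⟨t, ht, rfl⟩
    exact ⟨unitInterval.symm t, ⟨unitInterval.pos_iff_ne_zero.2 fun h => ht.2.ne (by simpa using h),
      unitInterval.lt_one_iff_ne_one.2 fun h => ht.1.ne' (by simpa using h)⟩, rfl⟩
  · rintro ⟨t, ht, rfl⟩
    exact ⟨unitInterval.symm t, ⟨unitInterval.pos_iff_ne_zero.2 fun h => ht.2.ne (by simpa using h),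
      unitInterval.lt_one_iff_ne_one.2 fun h => ht.1.ne' (by simpa using h)⟩, by simp⟩

theorem range_eq {g : C(unitInterval, G)} (h0 : g 0 = x) (h1 : g 1 = y) (he : g '' Ioo 0 1 = e) :
    range g = insert x (insert y e) := by
  rw [← image_univ, Icc_eq_insert_Ioo, image_insert_eq, image_insert_eq, h0, h1, he]

theorem ne (h : IsEdge e x y) : x ≠ y := by
  obtain ⟨g, hg, rfl, rfl, he⟩ := h.exists_path
  exact fun h => zero_ne_one (hg h)

theorem isPreconnected (h : IsEdge e x y) : IsPreconnected e := by
  obtain ⟨g, hg, h0, h1, rfl⟩ := h.exists_path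
  exact isPreconnected_Ioo.image _ g.continuous.continuousOn

theorem nonempty (h : IsEdge e x y) : e.Nonempty := by
  obtain ⟨g, hg, h0, h1, rfl⟩ := h.exists_path
  exact (nonempty_Ioo.2 zero_lt_one).image _

theorem closure_eq [T2Space G] (h : IsEdge e x y) : closure e = insert x (insert y e) := by
  obtain ⟨g, hg, h0, h1, rfl⟩ := h.exists_path
  rw [← range_eq h0 h1 rfl, ← image_univ, ← image_closure_of_isCompact _ g.continuous.continuousOn]
  · rw [closure_Ioo zero_ne_one]
    congr 1
    ext t
    exact ⟨fun _ => mem_univ t, fun _ => ⟨unitInterval.nonneg', unitInterval.le_one'⟩⟩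
  · exact isClosed_closure.isCompact

theorem left_mem_closure [T2Space G] (h : IsEdge e x y) : x ∈ closure e := by
  rw [h.closure_eq]; simp

theorem right_mem_closure [T2Space G] (h : IsEdge e x y) : y ∈ closure e := by
  rw [h.closure_eq]; simp

end IsEdge

/-- The space decomposes into the finite set `V` of vertices and the finite family `ℰ` of pairwise
disjoint open edges. -/
structure IsCellular (V : Set G) (ℰ : Set (Set G)) : Prop where
  finite_vertices : V.Finite
  finite_edges : ℰ.Finite
  pairwiseDisjoint : ℰ.PairwiseDisjoint id
  exists_isEdge : ∀ e ∈ ℰ, ∃ x ∈ V, ∃ y ∈ V, IsEdge e x y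
  disjoint_vertices : ∀ e ∈ ℰ, Disjoint e V
  cover : V ∪ ⋃₀ ℰ = univ

namespace IsCellular

variable {V : Set G} {ℰ : Set (Set G)}

theorem mem_or (h : IsCellular V ℰ) (x : G) : x ∈ V ∨ ∃ e ∈ ℰ, x ∈ e := by
  have : x ∈ V ∪ ⋃₀ ℰ := h.cover ▸ mem_univ x
  simpa using this

theorem Aligned.of_isOpen_compl (h : IsCellular V ℰ) {W W' : Set G} (hW : IsOpen W)
    (hW' : IsOpen W') (hd : Disjoint W W') (hc : (W ∪ W')ᶜ ⊆ V) : Aligned ℰ W := by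
  rintro e he ⟨x, hx, hxW⟩
  obtain ⟨a, -, b, -, hab⟩ := h.exists_isEdge e he
  refine hab.isPreconnected.subset_left_of_subset_union hW hW' hd ?_ ⟨x, hx, hxW⟩
  intro z hz
  by_contra hz'
  exact disjoint_left.1 (h.disjoint_vertices e he) hz (hc hz')

theorem closure_eq (h : IsCellular V ℰ) [T1Space G] {W : Set G} (hW : Aligned ℰ W) :
    closure W = (V ∩ W) ∪ ⋃ e ∈ {e ∈ ℰ | e ⊆ W}, closure e := by
  have hW' : W = (V ∩ W) ∪ ⋃ e ∈ {e ∈ ℰ | e ⊆ W}, e := by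
    ext x
    simp only [mem_union, mem_inter_iff, mem_iUnion, exists_prop]
    constructor
    · intro hx
      rcases h.mem_or x with hx' | ⟨e, he, hxe⟩
      · exact Or.inl ⟨hx', hx⟩
      · exact Or.inr ⟨e, ⟨he, hW e he ⟨x, hxe, hx⟩⟩, hxe⟩
    · rintro (hx | ⟨e, he, hx⟩)
      exacts [hx.2, he.2 hx]
  conv_lhs => rw [hW']
  rw [closure_union, (h.finite_vertices.subset inter_subset_left).isClosed.closure_eq,
    (h.finite_edges.subset (sep_subset _ _)).closure_biUnion]

theorem mem_closure (h : IsCellular V ℰ) [T1Space G] {W : Set G} (hW : Aligned ℰ W) {x : G}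
    (hx : x ∈ closure W) : x ∈ W ∨ ∃ e ∈ ℰ, e ⊆ W ∧ x ∈ closure e := by
  rw [h.closure_eq hW] at hx
  simp only [mem_union, mem_inter_iff, mem_iUnion, exists_prop, mem_ofPred_eq] at hx
  rcases hx with hx | ⟨e, he, hx⟩
  exacts [Or.inl hx.2, Or.inr ⟨e, he.1, he.2, hx⟩]

/-- An edge with an endpoint outside an aligned set, described by its other endpoint. -/
theorem exists_isEdge_of_mem_closure [T2Space G] (h : IsCellular V ℰ) {e : Set G} (he : e ∈ ℰ)
    {x : G} (hx : x ∈ closure e) (hxe : x ∉ e) : x ∈ V ∧ ∃ y ∈ V, IsEdge e x y := by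
  obtain ⟨a, ha, b, hb, hab⟩ := h.exists_isEdge e he
  rw [hab.closure_eq] at hx
  rcases hx with rfl | rfl | hx
  exacts [⟨ha, b, hb, hab⟩, ⟨hb, a, ha, hab.symm⟩, absurd hx hxe]

end IsCellular

end Cells

section FiniteGraphs

theorem exists_reparametrization {s t : unitInterval} (h : s < t) :
    ∃ c : C(unitInterval, unitInterval), StrictMono c ∧ c 0 = s ∧ c 1 = t ∧
      c '' Ioo 0 1 = Ioo s t := by
  have h' : (s : ℝ) < t := h
  have hs := s.2.1
  have ht := t.2.2
  let c : C(unitInterval, unitInterval) :=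
    ⟨fun r => ⟨s + r * (t - s), by
      have h1 := r.2.1; have h2 := r.2.2
      constructor <;> nlinarith⟩, by fun_prop⟩
  have h0 : c 0 = s := Subtype.ext (by simp [c])
  have h1 : c 1 = t := Subtype.ext (by simp [c])
  have hc : StrictMono c := fun a b hab => by
    have : (a : ℝ) < b := hab
    change (s + a * (t - s) : ℝ) < s + b * (t - s)
    nlinarith
  refine ⟨c, hc, h0, h1, subset_antisymm ?_ ?_⟩
  · rintro _ ⟨r, hr, rfl⟩
    rw [← h0, ← h1]
    exact ⟨hc hr.1, hc hr.2⟩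
  · have := intermediate_value_Ioo zero_le_one c.continuous.continuousOn
    rwa [h0, h1] at this

variable {G : Type*} [TopologicalSpace G]

theorem _root_.IsFiniteGraph.exists_paths (h : IsFiniteGraph G) :
    ∃ (𝒜 : Finset (Set G)) (g : 𝒜 → C(unitInterval, G)), (⋃ A ∈ 𝒜, A) = univ ∧
      (∀ A, Function.Injective (g A)) ∧ (∀ A, range (g A) = A) ∧
      ∀ A B : 𝒜, A ≠ B → ((A : Set G) ∩ B).Finite := by
  obtain ⟨𝒜, h1, h2, h3⟩ := h
  have : ∀ A : 𝒜, ∃ g : C(unitInterval, G), Function.Injective g ∧ range g = A := by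
    intro A
    obtain ⟨φ⟩ := h2 A A.2
    refine ⟨⟨fun t => φ t, by fun_prop⟩, Subtype.val_injective.comp φ.injective, ?_⟩
    change range (Subtype.val ∘ φ) = A
    rw [range_comp, φ.range_coe, image_univ, Subtype.range_coe]
  choose g hg hr using this
  exact ⟨𝒜, g, h1, hg, hr, fun A B hAB => h3 A A.2 B B.2 fun h => hAB (Subtype.ext h)⟩

theorem _root_.IsFiniteGraph.compactSpace (h : IsFiniteGraph G) : CompactSpace G := by
  obtain ⟨𝒜, g, h1, -, hr, -⟩ := h.exists_paths
  refine ⟨h1 ▸ 𝒜.finite_toSet.isCompact_biUnion fun A hA => ?_⟩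
  change IsCompact ((⟨A, hA⟩ : 𝒜) : Set G)
  rw [← hr ⟨A, hA⟩]
  exact isCompact_range (g _).continuous

theorem _root_.IsFiniteGraph.locallyConnectedSpace [T2Space G] (h : IsFiniteGraph G) :
    LocallyConnectedSpace G := by
  obtain ⟨𝒜, g, h1, -, hr, -⟩ := h.exists_paths
  let f : (Σ _ : 𝒜, unitInterval) → G := fun x => g x.1 x.2
  have hf : Continuous f := continuous_sigma fun A => (g A).continuous
  have hs : Function.Surjective f := by
    intro x
    obtain ⟨A, hA, hx⟩ := mem_iUnion₂.1 (h1.symm ▸ mem_univ x : x ∈ ⋃ A ∈ 𝒜, A)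
    have hx : x ∈ range (g ⟨A, hA⟩) := by rw [hr]; exact hx
    obtain ⟨t, rfl⟩ := hx
    exact ⟨⟨⟨A, hA⟩, t⟩, rfl⟩
  have hI : LocallyPathConnectedSpace unitInterval :=
    (isQuotientMap_projIcc (α := ℝ) (h := zero_le_one)).locallyPathConnectedSpace
  exact (hf.isClosedMap.isQuotientMap hf hs).isCoinducing.locallyConnectedSpace

theorem _root_.IsFiniteGraph.exists_isCellular [T2Space G] (h : IsFiniteGraph G) {F : Set G}
    (hF : F.Finite) : ∃ V ℰ, F ⊆ V ∧ IsCellular V ℰ := by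
  obtain ⟨𝒜, g, h1, hg, hr, hfin⟩ := h.exists_paths
  have hcov : ∀ x : G, ∃ (A : 𝒜) (t : unitInterval), g A t = x := by
    intro x
    obtain ⟨A, hA, hx⟩ := mem_iUnion₂.1 (h1.symm ▸ mem_univ x : x ∈ ⋃ A ∈ 𝒜, A)
    have hx : x ∈ range (g ⟨A, hA⟩) := by rw [hr]; exact hx
    exact ⟨⟨A, hA⟩, hx⟩
  set V : Set G := F ∪ ((⋃ A : 𝒜, ⋃ B ∈ {B : 𝒜 | A ≠ B}, ((A : Set G) ∩ B)) ∪
    ⋃ A : 𝒜, {g A 0, g A 1}) with hV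
  have hVfin : V.Finite := by
    refine hF.union (.union (finite_iUnion fun A => ?_) (finite_iUnion fun A => by simp))
    exact (toFinite _).biUnion fun B hB => hfin A B hB
  have hAB : ∀ (A B : 𝒜) (s t : unitInterval), g A s ∉ V → g A s = g B t → A = B := by
    intro A B s t hs hst
    by_contra hne
    refine hs (Or.inr (Or.inl ?_))
    simp only [mem_iUnion]
    exact ⟨A, B, hne, hr A ▸ mem_range_self s, hst ▸ hr B ▸ mem_range_self t⟩
  have h0 : ∀ A, g A 0 ∈ V := fun A => Or.inr (Or.inr (mem_iUnion.2 ⟨A, by simp⟩))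
  have h1' : ∀ A, g A 1 ∈ V := fun A => Or.inr (Or.inr (mem_iUnion.2 ⟨A, by simp⟩))
  have hT : ∀ A, (g A ⁻¹' V).Finite := fun A => hVfin.preimage (hg A).injOn
  let ℰ : Set (Set G) := {e | ∃ (A : 𝒜) (s t : unitInterval), g A s ∈ V ∧ g A t ∈ V ∧ s < t ∧
    (∀ u ∈ Ioo s t, g A u ∉ V) ∧ e = g A '' Ioo s t}
  refine ⟨V, ℰ, subset_union_left, hVfin, ?_, ?_, ?_, ?_, ?_⟩
  · refine (finite_iUnion fun A => (hT A).image2 (fun s t => g A '' Ioo s t) (hT A)).subset ?_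
    rintro e ⟨A, s, t, hs, ht, -, -, rfl⟩
    exact mem_iUnion.2 ⟨A, s, hs, t, ht, rfl⟩
  · rintro e ⟨A, s, t, hs, ht, hst, hst', rfl⟩ e' ⟨A', s', t', hs', ht', hst2, hst2', rfl⟩ hne
    refine disjoint_left.2 ?_
    rintro x ⟨u, hu, rfl⟩ ⟨u', hu', heq⟩
    obtain rfl := hAB A A' u u' (hst' u hu) heq.symm
    obtain rfl := hg A heq
    have e1 : s' ≤ s := not_lt.1 fun h => hst' s' ⟨h, hu'.1.trans hu.2⟩ hs'
    have e2 : s ≤ s' := not_lt.1 fun h => hst2' s ⟨h, hu.1.trans hu'.2⟩ hs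
    have e3 : t' ≤ t := not_lt.1 fun h => hst2' t ⟨hu'.1.trans hu.2, h⟩ ht
    have e4 : t ≤ t' := not_lt.1 fun h => hst' t' ⟨hu.1.trans hu'.2, h⟩ ht'
    exact hne (by rw [le_antisymm e1 e2, le_antisymm e3 e4])
  · rintro e ⟨A, s, t, hs, ht, hst, hst', rfl⟩
    refine ⟨_, hs, _, ht, ?_, ?_⟩
    · have hcl : IsClosed ((⋃ B ∈ {B : 𝒜 | A ≠ B}, range (g B)) ∪ g A '' (Iic s ∪ Ici t)) := by
        refine IsClosed.union ((toFinite _).isClosed_biUnion fun B _ =>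
          (isCompact_range (g B).continuous).isClosed) ?_
        exact ((isClosed_Iic.union isClosed_Ici).isCompact.image (g A).continuous).isClosed
      convert hcl.isOpen_compl using 1
      ext x
      constructor
      · rintro ⟨u, hu, rfl⟩ (hx | ⟨w, hw, hx⟩)
        · obtain ⟨B, hB, w, hw⟩ := mem_iUnion₂.1 hx
          exact hB (hAB A B u w (hst' u hu) hw.symm)
        · obtain rfl := hg A hx
          rcases hw with hw | hw
          exacts [not_le.2 hu.1 hw, not_le.2 hu.2 hw]
      · intro hx
        obtain ⟨B, u, rfl⟩ := hcov x
        have hBA : A = B := by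
          by_contra hne
          exact hx (Or.inl (mem_iUnion₂.2 ⟨B, hne, mem_range_self u⟩))
        subst hBA
        refine ⟨u, ⟨?_, ?_⟩, rfl⟩
        · exact not_le.1 fun h => hx (Or.inr ⟨u, Or.inl h, rfl⟩)
        · exact not_le.1 fun h => hx (Or.inr ⟨u, Or.inr h, rfl⟩)
    · obtain ⟨c, hc, hc0, hc1, hc2⟩ := exists_reparametrization hst
      refine ⟨(g A).comp c, (hg A).comp hc.injective, by simp [hc0], by simp [hc1], ?_⟩
      rw [ContinuousMap.coe_comp, image_comp, hc2]
  · rintro e ⟨A, s, t, hs, ht, hst, hst', rfl⟩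
    refine disjoint_left.2 ?_
    rintro _ ⟨u, hu, rfl⟩
    exact hst' u hu
  · refine eq_univ_iff_forall.2 fun x => ?_
    by_cases hx : x ∈ V
    · exact Or.inl hx
    obtain ⟨A, u, rfl⟩ := hcov x
    have hu0 : 0 < u := unitInterval.pos_iff_ne_zero.2 (by rintro rfl; exact hx (h0 A))
    have hu1 : u < 1 := unitInterval.lt_one_iff_ne_one.2 (by rintro rfl; exact hx (h1' A))
    obtain ⟨s, ⟨hsV, hsu⟩, hs⟩ := exists_max_image (g A ⁻¹' V ∩ Iio u) id
      ((hT A).subset inter_subset_left) ⟨0, h0 A, hu0⟩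
    obtain ⟨t, ⟨htV, htu⟩, ht⟩ := exists_min_image (g A ⁻¹' V ∩ Ioi u) id
      ((hT A).subset inter_subset_left) ⟨1, h1' A, hu1⟩
    refine Or.inr ⟨_, ⟨A, s, t, hsV, htV, lt_trans hsu htu, ?_, rfl⟩, u, ⟨hsu, htu⟩, rfl⟩
    intro w hw hwV
    rcases lt_trichotomy w u with h | rfl | h
    · exact not_lt.2 (hs w ⟨hwV, h⟩) hw.1
    · exact hx hwV
    · exact not_lt.2 (ht w ⟨hwV, h⟩) hw.2

/-- A nontrivial closed connected union of cells is a finite graph. -/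
theorem IsCellular.isFiniteGraph [T2Space G] {V : Set G} {ℰ : Set (Set G)} (h : IsCellular V ℰ)
    {K : Set G} (hK : IsClosed K) (hKc : IsPreconnected K) (hKn : K.Nontrivial)
    (hKE : IsCellular.Aligned ℰ K) : IsFiniteGraph K := by
  classical
  have hfin : {e ∈ ℰ | e ⊆ K}.Finite := h.finite_edges.subset (sep_subset _ _)
  have hcl : ∀ e ∈ ℰ, e ⊆ K → closure e ⊆ K := fun e _ he => closure_minimal he hK
  have hcov : K ⊆ ⋃ e ∈ {e ∈ ℰ | e ⊆ K}, closure e := by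
    intro x hx
    by_contra hx'
    have hclosed : IsClosed (⋃ e ∈ {e ∈ ℰ | e ⊆ K}, closure e) :=
      hfin.isClosed_biUnion fun _ _ => isClosed_closure
    have hVcl : IsClosed ((V ∩ K) \ {x}) :=
      (h.finite_vertices.subset fun y hy => hy.1.1).isClosed
    obtain ⟨y, hy, hyx⟩ := hKn.exists_ne x
    obtain ⟨z, -, hz1, hz2⟩ := isPreconnected_closed_iff.1 hKc {x}
      ((⋃ e ∈ {e ∈ ℰ | e ⊆ K}, closure e) ∪ ((V ∩ K) \ {x})) isClosed_singleton
      (hclosed.union hVcl) (by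
        intro z hz
        by_cases hzx : z = x
        · exact Or.inl hzx
        · rcases h.mem_or z with hzV | ⟨e, he, hze⟩
          · exact Or.inr (Or.inr ⟨⟨hzV, hz⟩, hzx⟩)
          · exact Or.inr (Or.inl (mem_iUnion₂.2 ⟨e, ⟨he, hKE e he ⟨z, hze, hz⟩⟩,
              subset_closure hze⟩))) ⟨x, hx, rfl⟩ (by
        refine ⟨y, hy, ?_⟩
        rcases h.mem_or y with hzV | ⟨e, he, hze⟩
        · exact Or.inr ⟨⟨hzV, hy⟩, hyx⟩
        · exact Or.inl (mem_iUnion₂.2 ⟨e, ⟨he, hKE e he ⟨y, hze, hy⟩⟩, subset_closure hze⟩))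
    rw [mem_singleton_iff.1 hz1] at hz2
    rcases hz2 with h | h
    exacts [hx' h, h.2 rfl]
  refine ⟨hfin.toFinset.image fun e => Subtype.val ⁻¹' closure e, ?_, ?_, ?_⟩
  · refine eq_univ_iff_forall.2 fun x => ?_
    obtain ⟨e, he, hxe⟩ := mem_iUnion₂.1 (hcov x.2)
    refine mem_iUnion₂.2 ⟨Subtype.val ⁻¹' closure e, ?_, hxe⟩
    exact Finset.mem_image.2 ⟨e, hfin.mem_toFinset.2 he, rfl⟩
  · intro A hA
    obtain ⟨e, he, rfl⟩ := Finset.mem_image.1 hA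
    have he := hfin.mem_toFinset.1 he
    obtain ⟨x, -, y, -, hxy⟩ := h.exists_isEdge e he.1
    obtain ⟨g, hg, h0, h1, hge⟩ := hxy.exists_path
    have hr : range g = closure e := by rw [IsEdge.range_eq h0 h1 hge, hxy.closure_eq]
    let g' : unitInterval → K := fun t => ⟨g t, hcl e he.1 he.2 (hr ▸ mem_range_self t)⟩
    have hg' : Topology.IsClosedEmbedding g' :=
      .of_continuous_injective_isClosedMap (by fun_prop)
        (fun a b hab => hg (congrArg Subtype.val hab)) (Continuous.isClosedMap (by fun_prop))
    have hr' : range g' = Subtype.val ⁻¹' closure e := by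
      ext z
      rw [mem_preimage, ← hr]
      constructor
      · rintro ⟨t, rfl⟩; exact ⟨t, rfl⟩
      · rintro ⟨t, ht⟩; exact ⟨t, Subtype.ext ht⟩
    exact ⟨hg'.isEmbedding.toHomeomorph.trans (Homeomorph.setCongr hr')⟩
  · intro A hA B hB hAB
    obtain ⟨e, he, rfl⟩ := Finset.mem_image.1 hA
    obtain ⟨f, hf, rfl⟩ := Finset.mem_image.1 hB
    have he := hfin.mem_toFinset.1 he
    have hf := hfin.mem_toFinset.1 hf
    refine Finite.subset (h.finite_vertices.preimage Subtype.val_injective.injOn) ?_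
    rintro z ⟨hz1, hz2⟩
    by_contra hzV
    have hz1' : z.1 ∈ e := by
      by_contra hze
      exact hzV (h.exists_isEdge_of_mem_closure he.1 hz1 hze).1
    have hz2' : z.1 ∈ f := by
      by_contra hzf
      exact hzV (h.exists_isEdge_of_mem_closure hf.1 hz2 hzf).1
    have hef : e ≠ f := by rintro rfl; exact hAB rfl
    exact disjoint_left.1 (h.pairwiseDisjoint he.1 hf.1 hef) hz1' hz2'

end FiniteGraphs

section Hyperspace

variable {G : Type*} [TopologicalSpace G]

/-- The subcontinua of `X` whose complement in `X` is connected. -/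
def ncSet (X : Set G) : Set (NonemptyCompacts G) :=
  {B | (B : Set G) ⊆ X ∧ IsPreconnected (B : Set G) ∧ IsPreconnected (X \ B)}

/-- Either an arc from `p` to `q`, or a single point `p = q`. -/
def IsArcOrPoint (L : Set G) (p q : G) : Prop :=
  (L = {p} ∧ p = q) ∨
    ∃ g : C(unitInterval, G), Function.Injective g ∧ g 0 = p ∧ g 1 = q ∧ range g = L

/-- Two tangles (or single points) `K` and `M` joined by an arc (or point) `L`. -/
def IsDumbbell (K L M : Set G) (p q : G) : Prop :=
  (K = {p} ∨ IsTangle K) ∧ (M = {q} ∨ IsTangle M) ∧ IsArcOrPoint L p q ∧ K ∩ L = {p} ∧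
    (K ∪ L) ∩ M = {q} ∧ K ∪ L ∪ M = univ

namespace IsArcOrPoint

variable {L L' : Set G} {p q r : G}

theorem left_mem (h : IsArcOrPoint L p q) : p ∈ L := by
  rcases h with ⟨rfl, rfl⟩ | ⟨g, -, rfl, -, rfl⟩
  exacts [rfl, mem_range_self 0]

theorem symm (h : IsArcOrPoint L p q) : IsArcOrPoint L q p := by
  rcases h with ⟨rfl, rfl⟩ | ⟨g, hg, rfl, rfl, rfl⟩
  · exact Or.inl ⟨rfl, rfl⟩
  · refine Or.inr ⟨g.comp ⟨unitInterval.symm, by fun_prop⟩,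
      hg.comp unitInterval.symm_bijective.injective, by simp, by simp, ?_⟩
    rw [ContinuousMap.coe_comp]
    exact unitInterval.symm_bijective.surjective.range_comp g

theorem right_mem (h : IsArcOrPoint L p q) : q ∈ L := h.symm.left_mem

theorem trans (h : IsArcOrPoint L p q) (h' : IsArcOrPoint L' q r) (hi : L ∩ L' = {q}) :
    IsArcOrPoint (L ∪ L') p r := by
  have hq := h.right_mem
  have hq' := h'.left_mem
  rcases h with ⟨rfl, rfl⟩ | ⟨g, hg, rfl, rfl, rfl⟩
  · rwa [singleton_union, insert_eq_of_mem hq']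
  rcases h' with ⟨rfl, rfl⟩ | ⟨g', hg', hg0, rfl, rfl⟩
  · rw [union_singleton, insert_eq_of_mem hq]
    exact Or.inr ⟨g, hg, rfl, rfl, rfl⟩
  let γ : Path (g 0) (g 1) := ⟨g, rfl, rfl⟩
  let γ' : Path (g 1) (g' 1) := ⟨g', hg0, rfl⟩
  refine Or.inr ⟨(γ.trans γ').toContinuousMap, ?_, by simp, by simp, γ.trans_range γ'⟩
  have key : ∀ s t : unitInterval, g s = g' t → s = 1 ∧ t = 0 := by
    intro s t hst
    have h1 : g s ∈ range g ∩ range g' := ⟨mem_range_self s, hst ▸ mem_range_self t⟩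
    rw [hi] at h1
    exact ⟨hg h1, hg' (hst.symm.trans (h1.trans hg0.symm))⟩
  have key' : ∀ s t : unitInterval, (s : ℝ) ≤ 1 / 2 → ¬ (t : ℝ) ≤ 1 / 2 →
      (γ.trans γ') s ≠ (γ.trans γ') t := by
    intro s t hs ht hst
    rw [Path.trans_apply, Path.trans_apply, dif_pos hs, dif_neg ht] at hst
    have := congrArg Subtype.val (key _ _ hst).2
    simp at this
    linarith
  intro s t hst
  change (γ.trans γ') s = (γ.trans γ') t at hst
  by_cases hs : (s : ℝ) ≤ 1 / 2 <;> by_cases ht : (t : ℝ) ≤ 1 / 2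
  · rw [Path.trans_apply, Path.trans_apply, dif_pos hs, dif_pos ht] at hst
    have := congrArg Subtype.val (hg hst)
    simp at this
    exact Subtype.ext this
  · exact absurd hst (key' s t hs ht)
  · exact absurd hst.symm (key' t s ht hs)
  · rw [Path.trans_apply, Path.trans_apply, dif_neg hs, dif_neg ht] at hst
    have := congrArg Subtype.val (hg' hst)
    simp at this
    exact Subtype.ext this

end IsArcOrPoint

theorem IsEdge.isArcOrPoint [T2Space G] {e : Set G} {x y : G} (h : IsEdge e x y) :
    IsArcOrPoint (closure e) x y := by
  obtain ⟨g, hg, h0, h1, he⟩ := h.exists_path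
  exact Or.inr ⟨g, hg, h0, h1, by rw [IsEdge.range_eq h0 h1 he, h.closure_eq]⟩

/-- Two disjoint ends cannot both miss a point which is not a cut-point. -/
theorem Separates.mem_of_isPreconnected_ncSet [T1Space G] [CompactSpace G] [ConnectedSpace G]
    {p q x : G} {C D C' D' : Set G} (hNC : IsPreconnected (ncSet (univ : Set G)))
    (h : Separates p C D) (h' : Separates q C' D') (hd : Disjoint C C')
    (hx : IsPreconnected ({x}ᶜ : Set G)) : x ∈ insert p C ∨ x ∈ insert q C' := by
  by_contra! hcon
  have hO : IsOpen ((insert p C)ᶜ ∩ (insert q C')ᶜ) :=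
    h.symm.isClosed_insert.isOpen_compl.inter h'.symm.isClosed_insert.isOpen_compl
  have key : ∀ (p q : G) (C D C' D' : Set G), Separates p C D → Separates q C' D' →
      Disjoint C C' → ∀ B ∈ ncSet (univ : Set G), Disjoint (B : Set G) (C ∪ C') →
      p ∉ (B : Set G) := by
    rintro p q C D C' D' h h' hd B hB hBd hp
    have hB2 := hB.2.2
    rw [← compl_eq_univ_sdiff] at hB2
    have hsub : (B : Set G)ᶜ ⊆ C ∪ D := by
      rw [h.union_eq]
      exact compl_subset_compl.2 (singleton_subset_iff.2 hp)
    have hBC : C ∪ C' ⊆ (B : Set G)ᶜ := fun z hz hzB => disjoint_left.1 hBd hzB hz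
    obtain ⟨y, hy⟩ := h.nonempty_left
    have := hB2.subset_left_of_subset_union h.isOpen_left h.isOpen_right h.disjoint hsub
      ⟨y, hBC (Or.inl hy), hy⟩
    obtain ⟨z, hz⟩ := h'.nonempty_left
    exact disjoint_left.1 hd (this (hBC (Or.inr hz))) hz
  obtain ⟨B, hB, hB1, hB2⟩ := hNC _ _ (NonemptyCompacts.isOpen_subsets_of_isOpen hO)
    (NonemptyCompacts.isOpen_inter_nonempty_of_isOpen (h.isOpen_left.union h'.isOpen_left))
    (by
      intro B hB
      by_cases hBd : Disjoint (B : Set G) (C ∪ C')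
      · left
        have hp := key p q C D C' D' h h' hd B hB hBd
        have hq := key q p C' D' C D h' h hd.symm B hB (by rwa [union_comm])
        intro z hz
        constructor
        · rintro (rfl | hzC)
          exacts [hp hz, disjoint_left.1 hBd hz (Or.inl hzC)]
        · rintro (rfl | hzC)
          exacts [hq hz, disjoint_left.1 hBd hz (Or.inr hzC)]
      · exact Or.inr (not_disjoint_iff_nonempty_inter.1 hBd))
    ⟨{x}, ⟨subset_univ _, by simpa using isPreconnected_singleton, by
      simpa [← compl_eq_univ_sdiff] using hx⟩, by simpa using hcon⟩
    ⟨⊤, ⟨subset_univ _, by simpa using isPreconnected_univ, by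
      simpa using isPreconnected_empty⟩, by
      simpa using h.nonempty_left.mono subset_union_left⟩
  obtain ⟨z, hz, hzC⟩ := hB2
  rcases hzC with hzC | hzC
  · exact (hB1 hz).1 (Or.inr hzC)
  · exact (hB1 hz).2 (Or.inr hzC)

namespace IsCellular

variable {V : Set G} {ℰ : Set (Set G)}

theorem aligned_of_separates (h : IsCellular V ℰ) {v : G} (hv : v ∈ V) {P D : Set G}
    (hs : Separates v P D) : Aligned ℰ P :=
  Aligned.of_isOpen_compl h hs.isOpen_left hs.isOpen_right hs.disjoint
    (by rw [hs.union_eq]; simpa)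

/-- Every side of a separation contains an edge at the separating vertex. -/
theorem exists_edge_of_separates [T2Space G] [PreconnectedSpace G] (h : IsCellular V ℰ) {v : G}
    (hv : v ∈ V) {P D : Set G} (hs : Separates v P D) :
    ∃ e ∈ ℰ, e ⊆ P ∧ ∃ z ∈ V ∩ P, IsEdge e v z := by
  rcases h.mem_closure (h.aligned_of_separates hv hs) hs.symm.mem_closure with
    hvP | ⟨e, he, heP, hve⟩
  · exact absurd hvP hs.notMem_left
  · obtain ⟨-, z, hz, hez⟩ := h.exists_isEdge_of_mem_closure he hve
      fun hve => hs.notMem_left (heP hve)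
    refine ⟨e, he, heP, z, ⟨hz, ?_⟩, hez⟩
    have := closure_minimal (heP.trans (subset_insert v P)) hs.symm.isClosed_insert
      hez.right_mem_closure
    exact this.resolve_left hez.ne.symm

theorem exists_not_cutpoint [T2Space G] [PreconnectedSpace G] (h : IsCellular V ℰ) (n : ℕ) :
    ∀ (v : G) (P D : Set G), v ∈ V → Separates v P D → (V ∩ P).ncard < n →
      ∃ x ∈ P, IsPreconnected ({x}ᶜ : Set G) := by
  induction n with
  | zero => intro v P D _ _ hn; exact absurd hn (Nat.not_lt_zero _)
  | succ n ih =>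
    intro v P D hv hs hn
    obtain ⟨e, he, heP, z, hz, hez⟩ := h.exists_edge_of_separates hv hs
    by_cases hzc : IsPreconnected ({z}ᶜ : Set G)
    · exact ⟨z, hz.2, hzc⟩
    obtain ⟨X, Y, hXY, hvX⟩ := exists_separates_of_not_isPreconnected hzc v hez.ne
    have hYP := hs.subset_of_mem hz.2 hXY hvX
    obtain ⟨x, hx, hx'⟩ := ih z Y X hz.1 hXY.symm (by
      refine lt_of_lt_of_le (ncard_lt_ncard ?_ (h.finite_vertices.subset inter_subset_left))
        (Nat.lt_succ_iff.1 hn)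
      refine ⟨inter_subset_inter_right _ hYP, fun hsub => ?_⟩
      exact hXY.symm.notMem_left (hsub hz).2)
    exact ⟨x, hYP hx, hx'⟩

theorem isTangle_of_separates [T2Space G] [ConnectedSpace G] (h : IsCellular V ℰ) {v : G}
    (hv : v ∈ V) {P D : Set G} (hs : Separates v P D) (hP : IsPreconnected P)
    (hcut : ∀ x ∈ P, IsPreconnected ({x}ᶜ : Set G)) : IsTangle (insert v P : Set G) := by
  refine ⟨h.isFiniteGraph hs.symm.isClosed_insert hs.symm.isConnected_insert.isPreconnected ?_ ?_,
    ?_⟩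
  · obtain ⟨x, hx⟩ := hs.nonempty_left
    exact ⟨v, mem_insert _ _, x, Or.inr hx, fun h => hs.notMem_left (h ▸ hx)⟩
  · rw [← hs.symm.compl_left]
    exact (h.aligned_of_separates hv hs.symm).compl
  · rintro ⟨x, hx⟩
    rw [← Topology.IsInducing.subtypeVal.isPreconnected_image]
    have himg : (Subtype.val '' ({⟨x, hx⟩}ᶜ : Set (insert v P : Set G))) =
        {x}ᶜ ∩ insert v P := by
      ext z
      simp [and_comm]
    rw [himg]
    rcases hx with rfl | hx
    · convert hP using 1
      ext z
      simp only [mem_inter_iff, mem_compl_iff, mem_singleton_iff, mem_insert_iff]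
      refine ⟨fun hz => hz.2.resolve_left hz.1, fun hz => ⟨?_, Or.inr hz⟩⟩
      rintro rfl
      exact hs.notMem_left hz
    · exact isPreconnected_inter_of_inter_eq_singleton hs.symm.isClosed_insert hs.isClosed_insert
        hs.inter_eq (hcut x hx) (by rw [hs.union_insert]; exact subset_univ _)

end IsCellular

end Hyperspace

section Necessity

variable {G : Type*} [TopologicalSpace G]

/-- A tangle (or a point) with an arc (or a point) attached to it, whose free end is `p`. -/
def IsChunk (X : Set G) (p : G) : Prop :=
  ∃ K L q, K ∪ L = X ∧ K ∩ L = {q} ∧ (K = {q} ∨ IsTangle K) ∧ IsArcOrPoint L p q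

theorem IsEdge.subset_of_separates [T2Space G] {e : Set G} {v z y : G} {X Y : Set G}
    (he : IsEdge e v z) (hs : Separates y X Y) (hvX : v ∈ X) (hy : y ∉ e) : e ⊆ X := by
  have hc : IsPreconnected (insert v e) := he.isPreconnected.subset_closure (subset_insert _ _)
    (insert_subset he.left_mem_closure subset_closure)
  refine (subset_insert v e).trans (hc.subset_left_of_subset_union hs.isOpen_left hs.isOpen_right
    hs.disjoint ?_ ⟨v, mem_insert _ _, hvX⟩)
  rw [hs.union_eq]
  rintro w (rfl | hw) rfl
  exacts [hs.notMem_left hvX, hy hw]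

namespace IsCellular

variable [T2Space G] [CompactSpace G] [ConnectedSpace G] {V : Set G} {ℰ : Set (Set G)}
  {v : G} {P D : Set G}

theorem isPreconnected_of_separates (h : IsCellular V ℰ)
    (hNC : IsPreconnected (ncSet (univ : Set G))) (hv : v ∈ V) (hs : Separates v P D) :
    IsPreconnected P := by
  by_contra hP
  obtain ⟨P₁, P₂, ho₁, ho₂, hd, hn₁, hn₂, rfl⟩ := IsOpen.exists_separation hs.isOpen_left hP
  have hd' := disjoint_union_left.1 hs.disjoint
  have hs₁ : Separates v P₁ (P₂ ∪ D) := ⟨ho₁, ho₂.union hs.isOpen_right,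
    disjoint_union_right.2 ⟨hd, hd'.1⟩, hn₁, hn₂.inl, by rw [← union_assoc, hs.union_eq]⟩
  have hs₂ : Separates v P₂ (P₁ ∪ D) := ⟨ho₂, ho₁.union hs.isOpen_right,
    disjoint_union_right.2 ⟨hd.symm, hd'.2⟩, hn₂, hn₁.inl, by
      rw [← union_assoc, union_comm P₂, hs.union_eq]⟩
  obtain ⟨x, hxD, hx⟩ := h.exists_not_cutpoint _ v D _ hv hs.symm (Nat.lt_succ_self _)
  have hxv : x ≠ v := fun hxv => hs.symm.notMem_left (hxv ▸ hxD)
  rcases hs₁.mem_of_isPreconnected_ncSet hNC hs₂ hd hx with hx' | hx'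
  · exact disjoint_left.1 hd'.1 (hx'.resolve_left hxv) hxD
  · exact disjoint_left.1 hd'.2 (hx'.resolve_left hxv) hxD

/-- If the side `P` of `v` contains a cut-point, then it contains only one edge at `v`. -/
theorem edge_unique (h : IsCellular V ℰ) (hNC : IsPreconnected (ncSet (univ : Set G)))
    (hv : v ∈ V) (hs : Separates v P D) {x : G} (hx : x ∈ P)
    (hxc : ¬ IsPreconnected ({x}ᶜ : Set G)) {e e' : Set G} (he : e ∈ ℰ) (he' : e' ∈ ℰ)
    (heP : e ⊆ P) (heP' : e' ⊆ P) {z z' : G} (hez : IsEdge e v z) (hez' : IsEdge e' v z') :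
    e = e' := by
  by_contra hne
  have hd : Disjoint e e' := h.pairwiseDisjoint he he' hne
  have hvx : v ≠ x := fun hvx => hs.notMem_left (hvx ▸ hx)
  obtain ⟨X, Y, hXY, hvX⟩ := exists_separates_of_not_isPreconnected hxc v hvx
  have hYP := hs.subset_of_mem hx hXY hvX
  have hcut : ∀ y ∈ X ∩ P, ¬ IsPreconnected ({y}ᶜ : Set G) := by
    rintro y ⟨hyX, hyP⟩ hy
    rcases hXY.symm.mem_of_isPreconnected_ncSet hNC hs.symm (hs.disjoint.mono_left hYP) hy with
      (rfl | h') | (rfl | h')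
    · exact hXY.notMem_left hyX
    · exact disjoint_left.1 hXY.disjoint hyX h'
    · exact hs.notMem_left hyP
    · exact disjoint_left.1 hs.disjoint hyP h'
  obtain ⟨y₁, hy₁X, hy₁⟩ := mem_closure_iff.1 hez.left_mem_closure X hXY.isOpen_left hvX
  obtain ⟨y₂, hy₂X, hy₂⟩ := mem_closure_iff.1 hez'.left_mem_closure X hXY.isOpen_left hvX
  have hvP : ∀ y ∈ P, v ≠ y := fun y hy hvy => hs.notMem_left (hvy ▸ hy)
  obtain ⟨X₁, Y₁, hs₁, hv₁⟩ := exists_separates_of_not_isPreconnected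
    (hcut y₁ ⟨hy₁X, heP hy₁⟩) v (hvP _ (heP hy₁))
  obtain ⟨X₂, Y₂, hs₂, hv₂⟩ := exists_separates_of_not_isPreconnected
    (hcut y₂ ⟨hy₂X, heP' hy₂⟩) v (hvP _ (heP' hy₂))
  have h₂₁ : y₂ ∈ X₁ := hez'.subset_of_separates hs₁ hv₁ (disjoint_left.1 hd hy₁) hy₂
  have h₁₂ : y₁ ∈ X₂ := hez.subset_of_separates hs₂ hv₂ (disjoint_right.1 hd hy₂) hy₁
  have hY : insert y₂ Y₂ ⊆ X₁ :=
    hs₂.isConnected_insert.isPreconnected.subset_left_of_subset_union hs₁.isOpen_left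
      hs₁.isOpen_right hs₁.disjoint (by
        rw [hs₁.union_eq, ← hs₂.compl_left]
        intro w hw hw'
        exact hw (mem_singleton_iff.1 hw' ▸ h₁₂)) ⟨y₂, mem_insert _ _, h₂₁⟩
  obtain ⟨w, hwD, hw⟩ := h.exists_not_cutpoint _ v D _ hv hs.symm (Nat.lt_succ_self _)
  have hdY : Disjoint Y₁ Y₂ :=
    disjoint_left.2 fun w h₁ h₂ => disjoint_left.1 hs₁.disjoint (hY (Or.inr h₂)) h₁
  rcases hs₁.symm.mem_of_isPreconnected_ncSet hNC hs₂.symm hdY hw with (rfl | h') | (rfl | h')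
  · exact disjoint_left.1 hs.disjoint (heP hy₁) hwD
  · exact disjoint_left.1 hs.disjoint (hs.subset_of_mem (heP hy₁) hs₁ hv₁ h') hwD
  · exact disjoint_left.1 hs.disjoint (heP' hy₂) hwD
  · exact disjoint_left.1 hs.disjoint (hs.subset_of_mem (heP' hy₂) hs₂ hv₂ h') hwD

end IsCellular

namespace IsCellular

variable {V : Set G} {ℰ : Set (Set G)} {v : G} {P D : Set G}

/-- Removing the only edge at `v` from the side `P`. -/
theorem separates_diff_closure [T2Space G] (h : IsCellular V ℰ) (hv : v ∈ V) (hs : Separates v P D)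
    {e : Set G} (he : e ∈ ℰ) (heP : e ⊆ P) {z : G} (hz : z ∈ V ∩ P) (hez : IsEdge e v z)
    (huniq : ∀ e' ∈ ℰ, e' ⊆ P → ∀ z', IsEdge e' v z' → e' = e)
    (hQ : (P \ closure e).Nonempty) :
    Separates z (P \ closure e) (D ∪ insert v e) := by
  have hvP := hs.notMem_left
  have hze : z ∉ e := fun hze => disjoint_left.1 (h.disjoint_vertices e he) hze hz.1
  have hzD : z ∉ D := disjoint_left.1 hs.disjoint hz.2
  have halign : Aligned ℰ (P \ closure e) := by
    rintro e' he' ⟨y, hye', hyP, hye⟩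
    refine subset_sdiff.2 ⟨h.aligned_of_separates hv hs e' he' ⟨y, hye', hyP⟩, ?_⟩
    have hne : e' ≠ e := by rintro rfl; exact hye (subset_closure hye')
    have hVd := disjoint_left.1 (h.disjoint_vertices e' he')
    rw [hez.closure_eq, disjoint_right]
    rintro w (rfl | rfl | hw) hw'
    · exact hVd hw' hv
    · exact hVd hw' hz.1
    · exact disjoint_left.1 (h.pairwiseDisjoint he' he hne) hw' hw
  have hcompl : (insert z (P \ closure e))ᶜ = D ∪ insert v e := by
    ext w
    have := hs.mem_or (x := w)
    have h1 : w ∈ P → w ∉ D := fun hw => disjoint_left.1 hs.disjoint hw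
    have h2 : w ∈ e → w ∈ P := fun hw => heP hw
    simp only [hez.closure_eq, mem_compl_iff, mem_insert_iff, mem_sdiff, mem_union]
    constructor
    · intro hw
      tauto
    · rintro (hw | rfl | hw)
      · have : w ≠ z := by rintro rfl; exact hzD hw
        tauto
      · have := hez.ne
        tauto
      · have : w ≠ z := by rintro rfl; exact hze hw
        tauto
  refine ⟨hs.isOpen_left.sdiff isClosed_closure, ?_, ?_, hQ, ⟨v, Or.inr (mem_insert _ _)⟩, ?_⟩
  · rw [← hcompl, isOpen_compl_iff]
    refine isClosed_of_closure_subset ?_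
    intro x hx
    rw [insert_eq, closure_union, closure_singleton] at hx
    rcases hx with rfl | hx
    · exact mem_insert _ _
    rcases h.mem_closure halign hx with hx' | ⟨e', he', hsub, hxe'⟩
    · exact Or.inr hx'
    have hdisj : Disjoint e' e := disjoint_left.2 fun w hw hw' =>
      (hsub hw).2 (subset_closure hw')
    have hxP : x ∈ insert v P :=
      closure_minimal (sdiff_subset.trans (subset_insert v P)) hs.symm.isClosed_insert hx
    rcases hxP with rfl | hxP
    · obtain ⟨-, y, -, hey⟩ := h.exists_isEdge_of_mem_closure he' hxe'
        fun hxe => hvP (hsub hxe).1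
      obtain rfl := huniq e' he' (hsub.trans sdiff_subset) y hey
      exact absurd (disjoint_self.1 hdisj) hey.nonempty.ne_empty
    · by_cases hxe : x ∈ closure e
      · rw [hez.closure_eq] at hxe
        rcases hxe with rfl | rfl | hxe
        · exact absurd hxP hvP
        · exact mem_insert _ _
        · obtain ⟨w, hwe, hw⟩ := mem_closure_iff.1 hxe' e hez.isOpen hxe
          exact absurd hwe (disjoint_left.1 hdisj hw)
      · exact Or.inr ⟨hxP, hxe⟩
  · rw [← hcompl]
    exact disjoint_compl_right.mono_left (subset_insert _ _)
  · rw [← hcompl]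
    ext w
    by_cases hw : w = z
    · subst hw; simp [hez.right_mem_closure]
    · simp [hw]; tauto

theorem isChunk_of_separates [T2Space G] [CompactSpace G] [ConnectedSpace G]
    (h : IsCellular V ℰ) (hNC : IsPreconnected (ncSet (univ : Set G))) (n : ℕ) :
    ∀ (v : G) (P D : Set G), v ∈ V → Separates v P D → (V ∩ P).ncard < n →
      IsChunk (insert v P) v := by
  induction n with
  | zero => intro v P D _ _ hn; exact absurd hn (Nat.not_lt_zero _)
  | succ n ih =>
    intro v P D hv hs hn
    by_cases hcut : ∀ x ∈ P, IsPreconnected ({x}ᶜ : Set G)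
    · exact ⟨insert v P, {v}, v, by simp, by simp, Or.inr
        (h.isTangle_of_separates hv hs (h.isPreconnected_of_separates hNC hv hs) hcut),
        Or.inl ⟨rfl, rfl⟩⟩
    push Not at hcut
    obtain ⟨x, hx, hxc⟩ := hcut
    obtain ⟨e, he, heP, z, hz, hez⟩ := h.exists_edge_of_separates hv hs
    have hsub : closure e ⊆ insert v P :=
      closure_minimal (heP.trans (subset_insert _ _)) hs.symm.isClosed_insert
    have hunion : insert z (P \ closure e) ∪ closure e = insert v P := by
      ext w
      have h1 : w ∈ closure e → w ∈ insert v P := fun hw => hsub hw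
      have h2 : w = z → w ∈ P := fun hw => hw ▸ hz.2
      have h3 : w = v → w ∈ closure e := fun hw => hw ▸ hez.left_mem_closure
      simp only [mem_union, mem_insert_iff, mem_sdiff] at *
      tauto
    rcases (P \ closure e).eq_empty_or_nonempty with hQ | hQ
    · rw [hQ, insert_empty_eq] at hunion
      refine ⟨{z}, closure e, z, hunion, ?_, Or.inl rfl, hez.isArcOrPoint⟩
      rw [inter_eq_left, singleton_subset_iff]
      exact hez.right_mem_closure
    · have hs' := h.separates_diff_closure hv hs he heP hz hez
        (fun e' he' heP' z' hez' => h.edge_unique hNC hv hs hx hxc he' he heP' heP hez' hez) hQ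
      obtain ⟨K, L, q, hKL, hKLq, hK, hL⟩ := ih z _ _ hz.1 hs' (by
        refine lt_of_lt_of_le (ncard_lt_ncard ?_ (h.finite_vertices.subset inter_subset_left))
          (Nat.lt_succ_iff.1 hn)
        exact ⟨inter_subset_inter_right _ sdiff_subset, fun hsub =>
          (hsub hz).2.2 hez.right_mem_closure⟩)
      have hmem : ∀ w ∈ closure e, w ∈ K ∪ L → w = z := by
        intro w hw hw'
        rw [hKL] at hw'
        exact hw'.resolve_right fun hw' => hw'.2 hw
      refine ⟨K, closure e ∪ L, q, ?_, ?_, hK, hez.isArcOrPoint.trans hL ?_⟩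
      · rw [union_left_comm, hKL, union_comm, hunion]
      · refine Subset.antisymm ?_ (hKLq.symm.subset.trans
          (inter_subset_inter_right _ subset_union_right))
        rintro w ⟨hwK, hwe | hwL⟩
        · obtain rfl := hmem w hwe (Or.inl hwK)
          exact hKLq.subset ⟨hwK, hL.left_mem⟩
        · exact hKLq.subset ⟨hwK, hwL⟩
      · refine Subset.antisymm (fun w hw => hmem w hw.1 (Or.inr hw.2)) ?_
        rw [singleton_subset_iff]
        exact ⟨hez.right_mem_closure, hL.left_mem⟩

end IsCellular

theorem exists_isDumbbell [T2Space G] [CompactSpace G] [ConnectedSpace G] (h : IsFiniteGraph G)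
    (hNC : IsPreconnected (ncSet (univ : Set G))) :
    IsTangle G ∨ ∃ (K L M : Set G) (p q : G), IsDumbbell K L M p q := by
  by_cases hcut : ∀ x : G, IsPreconnected ({x}ᶜ : Set G)
  · exact Or.inl ⟨h, hcut⟩
  right
  push Not at hcut
  obtain ⟨v, hv⟩ := hcut
  obtain ⟨P, D, ho₁, ho₂, hd, hn₁, hn₂, hPD⟩ := IsOpen.exists_separation isOpen_compl_singleton hv
  have hs : Separates v P D := ⟨ho₁, ho₂, hd, hn₁, hn₂, hPD⟩
  obtain ⟨V, ℰ, hvV, hc⟩ := h.exists_isCellular (finite_singleton v)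
  rw [singleton_subset_iff] at hvV
  obtain ⟨K₁, L₁, q₁, hKL₁, hq₁, hK₁, hL₁⟩ :=
    hc.isChunk_of_separates hNC _ v P D hvV hs (Nat.lt_succ_self _)
  obtain ⟨K₂, L₂, q₂, hKL₂, hq₂, hK₂, hL₂⟩ :=
    hc.isChunk_of_separates hNC _ v D P hvV hs.symm (Nat.lt_succ_self _)
  have hmem : ∀ w ∈ K₁ ∪ L₁, w ∈ K₂ ∪ L₂ → w = v := by
    intro w h₁ h₂
    rw [hKL₁] at h₁
    rw [hKL₂] at h₂
    exact hs.inter_eq.subset ⟨h₁, h₂⟩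
  refine ⟨K₁, L₁ ∪ L₂, K₂, q₁, q₂, hK₁, hK₂, hL₁.symm.trans hL₂ ?_, ?_, ?_, ?_⟩
  · refine Subset.antisymm (fun w hw => hmem w (Or.inr hw.1) (Or.inr hw.2)) ?_
    exact singleton_subset_iff.2 ⟨hL₁.left_mem, hL₂.left_mem⟩
  · refine Subset.antisymm ?_ (hq₁.symm.subset.trans
      (inter_subset_inter_right _ subset_union_left))
    rintro w ⟨hwK, hw | hw⟩
    · exact hq₁.subset ⟨hwK, hw⟩
    · obtain rfl := hmem w (Or.inl hwK) (Or.inr hw)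
      exact hq₁.subset ⟨hwK, hL₁.left_mem⟩
  · refine Subset.antisymm ?_ (singleton_subset_iff.2
      ⟨Or.inr (Or.inr hL₂.right_mem), (hq₂.symm.subset rfl).1⟩)
    rintro w ⟨hw, hwK⟩
    rw [← union_assoc] at hw
    rcases hw with hw | hw
    · obtain rfl := hmem w hw (Or.inl hwK)
      exact hq₂.subset ⟨hwK, hL₂.left_mem⟩
    · exact hq₂.subset ⟨hwK, hw⟩
  · rw [← hs.union_insert, ← hKL₁, ← hKL₂, ← union_assoc, union_assoc, union_comm L₂]

end Necessity

section Growth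

variable {G : Type*} [TopologicalSpace G]

/-- There is a connected family in `ncSet X` joining `A` to `X` whose members contain `A`, and in
which `X` is the only member containing points of `P` outside `A`. -/
def Grows (X : NonemptyCompacts G) (P : Set G) (A : NonemptyCompacts G) : Prop :=
  ∃ 𝒞 ⊆ ncSet (X : Set G), IsPreconnected 𝒞 ∧ A ∈ 𝒞 ∧ X ∈ 𝒞 ∧
    ∀ C ∈ 𝒞, (A : Set G) ⊆ C ∧ ∀ p ∈ P, p ∈ C → p ∉ A → C = X

theorem Grows.of_subset {X A : NonemptyCompacts G} {P Q : Set G} (h : Grows X P A)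
    (hQ : Q ⊆ P ∪ A) : Grows X Q A := by
  obtain ⟨𝒞, h1, h2, h3, h4, h5⟩ := h
  exact ⟨𝒞, h1, h2, h3, h4, fun C hC => ⟨(h5 C hC).1, fun p hp hpC hpA =>
    (h5 C hC).2 p ((hQ hp).resolve_right hpA) hpC hpA⟩⟩

section Join

variable {X Y : NonemptyCompacts G} {q : G}

theorem mem_ncSet_sup_of_notMem (hXY : (X : Set G) ∩ Y = {q}) (hY : IsPreconnected (Y : Set G))
    {B : NonemptyCompacts G} (hB : B ∈ ncSet (X : Set G)) (hq : q ∉ B) :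
    B ∈ ncSet ((X ⊔ Y : NonemptyCompacts G) : Set G) := by
  have hq' : q ∈ (X : Set G) ∩ Y := hXY ▸ mem_singleton q
  refine ⟨hB.1.trans (by simp), hB.2.1, ?_⟩
  have hYB : Disjoint (Y : Set G) B := disjoint_left.2 fun y hy hyB =>
    hq ((hXY.subset ⟨hB.1 hyB, hy⟩ : y = q) ▸ hyB)
  rw [NonemptyCompacts.coe_sup, union_sdiff_distrib, hYB.sdiff_eq_left]
  exact hB.2.2.union q ⟨hq'.1, hq⟩ hq'.2 hY

theorem sup_mem_ncSet_sup (hXY : (X : Set G) ∩ Y = {q}) (hX : IsPreconnected (X : Set G))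
    {B : NonemptyCompacts G} (hB : B ∈ ncSet (Y : Set G)) (hq : q ∈ B) :
    X ⊔ B ∈ ncSet ((X ⊔ Y : NonemptyCompacts G) : Set G) := by
  have hq' : q ∈ (X : Set G) ∩ Y := hXY ▸ mem_singleton q
  refine ⟨by simpa using hB.1.trans subset_union_right, ?_, ?_⟩
  · rw [NonemptyCompacts.coe_sup]
    exact hX.union q hq'.1 hq hB.2.1
  · convert hB.2.2 using 1
    ext y
    have h1 : y ∈ X → y ∈ Y → y = q := fun h1 h2 => hXY.subset ⟨h1, h2⟩
    have h2 : y = q → y ∈ B := fun h => h ▸ hq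
    simp only [NonemptyCompacts.coe_sup, mem_sdiff, mem_union, SetLike.mem_coe]
    tauto

theorem sup_singleton_eq (hXY : (X : Set G) ∩ Y = {q}) : X ⊔ {q} = X := by
  have hq' : q ∈ (X : Set G) ∩ Y := hXY ▸ mem_singleton q
  apply SetLike.coe_injective
  simpa using hq'.1

theorem Grows.sup_of_notMem (hXY : (X : Set G) ∩ Y = {q}) (hX : IsPreconnected (X : Set G))
    (hY : IsPreconnected (Y : Set G)) {A : NonemptyCompacts G} {P : Set G} (hq : q ∉ A)
    (hPY : P ⊆ Y) (hqP : q ∉ P) (h : Grows X {q} A) (h' : Grows Y P {q}) :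
    Grows (X ⊔ Y) P A := by
  obtain ⟨𝒞, h1, h2, h3, h4, h5⟩ := h
  obtain ⟨𝒟, k1, k2, k3, k4, k5⟩ := h'
  have hPX : ∀ p ∈ P, p ∉ X := fun p hp hpX => hqP ((hXY.subset ⟨hpX, hPY hp⟩ : p = q) ▸ hp)
  have hq𝒟 : ∀ B ∈ 𝒟, q ∈ B := fun B hB => (k5 B hB).1 (by simp)
  refine ⟨𝒞 ∪ (X ⊔ ·) '' 𝒟, ?_, ?_, Or.inl h3, Or.inr ⟨Y, k4, rfl⟩, ?_⟩
  · rintro B (hB | ⟨B, hB, rfl⟩)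
    · by_cases hqB : q ∈ B
      · obtain rfl := (h5 B hB).2 q rfl hqB hq
        have hmem := sup_mem_ncSet_sup hXY hX (k1 k3) (by simp)
        rwa [sup_singleton_eq hXY] at hmem
      · exact mem_ncSet_sup_of_notMem hXY hY (h1 hB) hqB
    · exact sup_mem_ncSet_sup hXY hX (k1 hB) (hq𝒟 B hB)
  · exact h2.union X h4 ⟨{q}, k3, sup_singleton_eq hXY⟩
      (k2.image _ (continuous_const.sup continuous_id).continuousOn)
  · rintro B (hB | ⟨B, hB, rfl⟩)
    · exact ⟨(h5 B hB).1, fun p hp hpB => absurd ((h1 hB).1 hpB) (hPX p hp)⟩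
    · refine ⟨((h1 h3).1).trans (by simp), fun p hp hpB _ => ?_⟩
      have hpB' : p ∈ B := by
        have : p ∈ X ∨ p ∈ B := by simpa [← SetLike.mem_coe] using hpB
        exact this.resolve_left (hPX p hp)
      obtain rfl := (k5 B hB).2 p hp hpB' (by
        rw [NonemptyCompacts.mem_singleton]; rintro rfl; exact hqP hp)
      rfl

theorem Grows.sup_of_subset [T2Space G] (hXY : (X : Set G) ∩ Y = {q})
    (hX : IsPreconnected (X : Set G)) {A : NonemptyCompacts G} {P : Set G} (hq : q ∈ A)
    (hA : A ∈ ncSet ((X ⊔ Y : NonemptyCompacts G) : Set G)) (hXA : (X : Set G) ⊆ A)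
    (h : ∀ B ∈ ncSet (Y : Set G), Grows Y P B) : Grows (X ⊔ Y) P A := by
  have hq' : q ∈ (X : Set G) ∩ Y := hXY ▸ mem_singleton q
  have hAXY : (A : Set G) ⊆ X ∪ Y := by simpa using hA.1
  let B₀ : NonemptyCompacts G := ⟨⟨(A : Set G) ∩ Y, A.isCompact.inter Y.isCompact⟩, ⟨q, hq, hq'.2⟩⟩
  have hB₀ : (B₀ : Set G) = (A : Set G) ∩ Y := rfl
  have hAB₀ : X ⊔ B₀ = A := by
    apply SetLike.coe_injective
    ext y
    have := @hAXY y
    have := @hXA y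
    simp only [NonemptyCompacts.coe_sup, hB₀, mem_union, mem_inter_iff] at *
    tauto
  have hB₀' : B₀ ∈ ncSet (Y : Set G) := by
    refine ⟨inter_subset_right, ?_, ?_⟩
    · exact isPreconnected_inter_of_inter_eq_singleton Y.isCompact.isClosed X.isCompact.isClosed
        (by rw [inter_comm, hXY]) hA.2.1 (by rwa [union_comm])
    · convert hA.2.2 using 1
      ext y
      have := @hXA y
      simp only [NonemptyCompacts.coe_sup, hB₀, mem_union, mem_inter_iff, mem_sdiff] at *
      tauto
  obtain ⟨𝒟, k1, k2, k3, k4, k5⟩ := h B₀ hB₀'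
  refine ⟨(X ⊔ ·) '' 𝒟, ?_, k2.image _ (continuous_const.sup continuous_id).continuousOn,
    ⟨B₀, k3, hAB₀⟩, ⟨Y, k4, rfl⟩, ?_⟩
  · rintro _ ⟨B, hB, rfl⟩
    exact sup_mem_ncSet_sup hXY hX (k1 hB) ((k5 B hB).1 ⟨hq, hq'.2⟩)
  · rintro _ ⟨B, hB, rfl⟩
    constructor
    · conv_lhs => rw [← hAB₀]
      simp only [NonemptyCompacts.coe_sup]
      exact union_subset_union_right _ (k5 B hB).1
    · intro p hp hpB hpA
      have hpB' : p ∈ B := by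
        have : p ∈ X ∨ p ∈ B := by simpa [← SetLike.mem_coe] using hpB
        exact this.resolve_left fun hpX => hpA (hXA hpX)
      obtain rfl := (k5 B hB).2 p hp hpB' fun hp' => hpA hp'.1
      rfl

theorem Grows.sup [T2Space G] (hXY : (X : Set G) ∩ Y = {q}) (hX : IsPreconnected (X : Set G))
    (hY : IsPreconnected (Y : Set G)) (hXq : IsPreconnected ((X : Set G) \ {q}))
    (hYq : IsPreconnected ((Y : Set G) \ {q})) {P : Set G} (hPY : P ⊆ Y) (hqP : q ∉ P)
    (hgX : ∀ A ∈ ncSet (X : Set G), Grows X {q} A)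
    (hgY : ∀ A ∈ ncSet (Y : Set G), Grows Y (insert q P) A)
    (hP : ∀ A ∈ ncSet (Y : Set G), q ∉ A → P ⊆ A) {A : NonemptyCompacts G}
    (hA : A ∈ ncSet ((X ⊔ Y : NonemptyCompacts G) : Set G)) : Grows (X ⊔ Y) P A := by
  have hq' : q ∈ (X : Set G) ∩ Y := hXY ▸ mem_singleton q
  have hYX : (Y : Set G) ∩ X = {q} := by rw [inter_comm, hXY]
  have hXc := X.isCompact.isClosed
  have hYc := Y.isCompact.isClosed
  have hAXY : (A : Set G) ⊆ X ∪ Y := by simpa using hA.1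
  have split : ∀ S : Set G, IsPreconnected S → S ⊆ X ∪ Y → q ∉ S → S ⊆ X ∨ S ⊆ Y := by
    intro S hS hSXY hqS
    by_contra! hcon
    obtain ⟨⟨y, hy, hyX⟩, ⟨x, hx, hxY⟩⟩ := And.imp not_subset.1 not_subset.1 hcon
    obtain ⟨z, hz, hzXY⟩ := isPreconnected_closed_iff.1 hS X Y hXc hYc hSXY
      ⟨x, hx, (hSXY hx).resolve_right hxY⟩ ⟨y, hy, (hSXY hy).resolve_left hyX⟩
    exact hqS ((hXY.subset hzXY : z = q) ▸ hz)
  by_cases hq : q ∈ A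
  · rcases split _ hA.2.2 (by simp) (fun h => h.2 hq) with h | h
    · have hYA : (Y : Set G) ⊆ A := by
        intro y hy
        by_contra hyA
        have hyX := h ⟨by simp [hy], hyA⟩
        exact hyA ((hXY.subset ⟨hyX, hy⟩ : y = q) ▸ hq)
      rw [sup_comm] at hA ⊢
      exact (Grows.sup_of_subset hYX hY hq hA hYA hgX).of_subset
        (hPY.trans (hYA.trans subset_union_right))
    · have hXA : (X : Set G) ⊆ A := by
        intro y hy
        by_contra hyA
        have hyY := h ⟨by simp [hy], hyA⟩
        exact hyA ((hXY.subset ⟨hy, hyY⟩ : y = q) ▸ hq)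
      exact Grows.sup_of_subset hXY hX hq hA hXA fun B hB => (hgY B hB).of_subset
        ((subset_insert q P).trans subset_union_left)
  · rcases split _ hA.2.1 hAXY hq with h | h
    · have hAX : A ∈ ncSet (X : Set G) := by
        refine ⟨h, hA.2.1, ?_⟩
        have := isPreconnected_inter_of_inter_eq_singleton hXc hYc hXY hA.2.2 (by simp)
        convert this using 1
        ext y
        simp only [mem_sdiff, mem_inter_iff, NonemptyCompacts.coe_sup, mem_union]
        tauto
      exact Grows.sup_of_notMem hXY hX hY hq hPY hqP (hgX A hAX)
        ((hgY {q} ⟨by simpa using hq'.2, by simpa using isPreconnected_singleton, by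
          simpa using hYq⟩).of_subset ((subset_insert q P).trans subset_union_left))
    · have hAY : A ∈ ncSet (Y : Set G) := by
        refine ⟨h, hA.2.1, ?_⟩
        have := isPreconnected_inter_of_inter_eq_singleton hYc hXc hYX hA.2.2
          (by simp [union_comm])
        convert this using 1
        ext y
        simp only [mem_sdiff, mem_inter_iff, NonemptyCompacts.coe_sup, mem_union]
        tauto
      rw [sup_comm]
      refine (Grows.sup_of_notMem hYX hY hX hq (empty_subset _) (notMem_empty q)
        ((hgY A hAY).of_subset (Q := {q}) (by simp)) ((hgX {q} ⟨by simpa using hq'.1, by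
          simpa using isPreconnected_singleton, by simpa using hXq⟩).of_subset
            (empty_subset _))).of_subset ?_
      exact (hP A hAY hq).trans subset_union_right

end Join

end Growth

section Sweep

variable {G : Type*} [TopologicalSpace G]

/-- Enlarging `A` continuously along finitely many paths starting in `A`. -/
theorem exists_sweep {ι : Type*} (A : NonemptyCompacts G) (hA : IsPreconnected (A : Set G))
    {S : Set ι} (hS : S.Finite) (g : ι → C(unitInterval, G)) (hg : ∀ i ∈ S, g i 0 ∈ A) :
    ∃ F : unitInterval → NonemptyCompacts G, Continuous F ∧
      ∀ t, IsPreconnected (F t : Set G) ∧ (F t : Set G) = (A : Set G) ∪ ⋃ i ∈ S, g i '' Iic t := by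
  induction S, hS using Set.Finite.induction_on with
  | empty => exact ⟨fun _ => A, continuous_const, by simpa⟩
  | @insert i S _ _ ih =>
    obtain ⟨F, hF, hFt⟩ := ih fun j hj => hg j (Or.inr hj)
    let k : unitInterval → C(unitInterval, G) :=
      fun t => (g i).comp ⟨fun s => min t s, by fun_prop⟩
    have hk : ∀ t, (((⊤ : NonemptyCompacts unitInterval).map (k t) (k t).continuous :
        NonemptyCompacts G) : Set G) = g i '' Iic t := by
      intro t
      ext x
      simp only [NonemptyCompacts.coe_map, NonemptyCompacts.coe_top, image_univ, mem_range,
        mem_image, mem_Iic, k, ContinuousMap.comp_apply, ContinuousMap.coe_mk]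
      constructor
      · rintro ⟨s, rfl⟩
        exact ⟨_, min_le_left _ _, rfl⟩
      · rintro ⟨s, hs, rfl⟩
        exact ⟨s, by rw [min_eq_right hs]⟩
    refine ⟨fun t => F t ⊔ (⊤ : NonemptyCompacts unitInterval).map (k t) (k t).continuous,
      hF.sup (Continuous.nonemptyCompacts_map' continuous_const ?_), fun t => ⟨?_, ?_⟩⟩
    · simp only [k, Function.uncurry_def, ContinuousMap.comp_apply, ContinuousMap.coe_mk]
      fun_prop
    · rw [NonemptyCompacts.coe_sup, hk]
      refine (hFt t).1.union (g i 0) ?_ ⟨0, unitInterval.nonneg', rfl⟩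
        (isPreconnected_Iic.image _ (g i).continuous.continuousOn)
      rw [(hFt t).2]
      exact Or.inl (hg i (mem_insert _ _))
    · rw [NonemptyCompacts.coe_sup, hk, (hFt t).2, biUnion_insert, union_assoc,
        union_comm (g i '' Iic t)]

theorem preimage_isPreconnected [T2Space G] {g : C(unitInterval, G)} (hg : Function.Injective g)
    {S : Set G} (hS : IsPreconnected S) (hSg : S ⊆ range g) : IsPreconnected (g ⁻¹' S) := by
  have hi := (g.continuous.isClosedEmbedding hg).isInducing
  rwa [← hi.isPreconnected_image, image_preimage_eq_of_subset hSg]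

theorem grows_arc_of_mem [T2Space G] {g : C(unitInterval, G)} (hg : Function.Injective g)
    {X A : NonemptyCompacts G} (hX : (X : Set G) = range g) (hA : A ∈ ncSet (X : Set G))
    (h0 : g 0 ∈ A) : Grows X {g 0, g 1} A := by
  obtain ⟨F, hF, hFt⟩ := exists_sweep A hA.2.1 (finite_singleton ()) (fun _ => g) (by simpa)
  simp only [mem_singleton_iff, iUnion_const] at hFt
  have hF0 : F 0 = A := by
    apply SetLike.coe_injective
    rw [(hFt 0).2, union_eq_left]
    rintro _ ⟨t, ht, rfl⟩
    obtain rfl := le_antisymm ht unitInterval.nonneg'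
    exact h0
  have hF1 : F 1 = X := by
    apply SetLike.coe_injective
    rw [(hFt 1).2, hX]
    refine Subset.antisymm (union_subset (hX ▸ hA.1) (image_subset_range _ _)) ?_
    rintro _ ⟨t, rfl⟩
    exact Or.inr ⟨t, unitInterval.le_one', rfl⟩
  refine ⟨range F, ?_, isPreconnected_range hF, ⟨0, hF0⟩, ⟨1, hF1⟩, ?_⟩
  · rintro _ ⟨t, rfl⟩
    refine ⟨?_, (hFt t).1, ?_⟩
    · rw [(hFt t).2, hX]
      exact union_subset (hX ▸ hA.1) (image_subset_range _ _)
    · have hS := preimage_isPreconnected hg hA.2.2 (by rw [hX]; exact sdiff_subset)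
      rw [isPreconnected_iff_ordConnected] at hS
      have hS' : IsPreconnected (g ⁻¹' (X \ A) ∩ Ioi t) :=
        isPreconnected_iff_ordConnected.2 (hS.inter ordConnected_Ioi)
      convert hS'.image g g.continuous.continuousOn using 1
      rw [(hFt t).2, hX]
      ext x
      constructor
      · rintro ⟨⟨s, rfl⟩, hs⟩
        refine ⟨s, ⟨⟨mem_range_self s, fun h => hs (Or.inl h)⟩, ?_⟩, rfl⟩
        exact not_le.1 fun h => hs (Or.inr ⟨s, mem_Iic.2 h, rfl⟩)
      · rintro ⟨s, ⟨hs, hst⟩, rfl⟩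
        refine ⟨mem_range_self s, ?_⟩
        rintro (h | ⟨r, hr, hrs⟩)
        · exact hs.2 h
        · rw [hg hrs] at hr
          exact not_le.2 (mem_Ioi.1 hst) (mem_Iic.1 hr)
  · rintro _ ⟨t, rfl⟩
    refine ⟨by rw [(hFt t).2]; exact subset_union_left, ?_⟩
    rintro p (rfl | rfl) hp hpA
    · exact absurd h0 hpA
    · rw [← SetLike.mem_coe, (hFt t).2] at hp
      rcases hp with hp | ⟨s, hs, hs1⟩
      · exact absurd hp hpA
      · rw [hg hs1] at hs
        rw [le_antisymm unitInterval.le_one' hs, hF1]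

theorem mem_of_notMem_arc [T2Space G] {g : C(unitInterval, G)} (hg : Function.Injective g)
    {X A : NonemptyCompacts G} (hX : (X : Set G) = range g) (hA : A ∈ ncSet (X : Set G))
    (h0 : g 0 ∉ A) : g 1 ∈ A := by
  by_contra h1
  have hS := preimage_isPreconnected hg hA.2.2 (by rw [hX]; exact sdiff_subset)
  rw [isPreconnected_iff_ordConnected] at hS
  have hm : ∀ t, g t ∉ A → t ∈ g ⁻¹' (X \ A) := fun t ht => ⟨hX ▸ mem_range_self t, ht⟩
  obtain ⟨x, hx⟩ := A.nonempty
  obtain ⟨t, rfl⟩ := hX.subset (hA.1 hx)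
  exact (hS.out (hm 0 h0) (hm 1 h1) ⟨unitInterval.nonneg', unitInterval.le_one'⟩).2 hx

theorem grows_arc [T2Space G] {g : C(unitInterval, G)} (hg : Function.Injective g)
    {X A : NonemptyCompacts G} (hX : (X : Set G) = range g) (hA : A ∈ ncSet (X : Set G)) :
    Grows X {g 0, g 1} A := by
  by_cases h0 : g 0 ∈ A
  · exact grows_arc_of_mem hg hX hA h0
  have h1 := mem_of_notMem_arc hg hX hA h0
  have := grows_arc_of_mem (g := g.comp ⟨unitInterval.symm, by fun_prop⟩)
    (hg.comp unitInterval.symm_bijective.injective)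
    (hX.trans (unitInterval.symm_bijective.surjective.range_comp g).symm) hA (by simpa)
  simpa [pair_comm] using this

end Sweep

section Tangle

variable {G : Type*} [TopologicalSpace G]

/-- In the complement of `A`, the point `v` separates the connected set `C` from `O`; moreover `C`
contains `p` unless `v = p`. -/
structure IsSplitting (p : G) (A : Set G) (v : G) (C O : Set G) : Prop where
  isOpen_left : IsOpen C
  isOpen_right : IsOpen O
  disjoint : Disjoint C O
  union_eq : C ∪ O = Aᶜ \ {v}
  isPreconnected : IsPreconnected C
  mem_or : p ∈ C ∨ (v = p ∧ C = ∅)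

theorem exists_isSplitting [T1Space G] [LocallyConnectedSpace G] {p v : G} {A : Set G}
    (hA : IsClosed A) (hp : p ∉ A) : ∃ C O, IsSplitting p A v C O := by
  have hU : IsOpen (Aᶜ \ {v}) := hA.isOpen_compl.sdiff isClosed_singleton
  by_cases hvp : v = p
  · exact ⟨∅, Aᶜ \ {v}, isOpen_empty, hU, empty_disjoint _, empty_union _, isPreconnected_empty,
      Or.inr ⟨hvp, rfl⟩⟩
  have hpU : p ∈ Aᶜ \ {v} := ⟨hp, fun h => hvp h.symm⟩
  have hC := hU.connectedComponentIn (x := p)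
  have hCU := connectedComponentIn_subset (Aᶜ \ {v}) p
  refine ⟨connectedComponentIn (Aᶜ \ {v}) p, (Aᶜ \ {v}) \ connectedComponentIn (Aᶜ \ {v}) p, hC,
    ?_, disjoint_sdiff_right, union_sdiff_cancel hCU, isPreconnected_connectedComponentIn,
    Or.inl (mem_connectedComponentIn hpU)⟩
  rw [isOpen_iff_forall_mem_open]
  rintro x ⟨hx, hxC⟩
  refine ⟨connectedComponentIn (Aᶜ \ {v}) x, fun y hy =>
    ⟨connectedComponentIn_subset _ _ hy, fun hyC => hxC ?_⟩, hU.connectedComponentIn,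
    mem_connectedComponentIn hx⟩
  rw [connectedComponentIn_eq hyC, ← connectedComponentIn_eq hy]
  exact mem_connectedComponentIn hx

namespace IsSplitting

variable {p v : G} {A C O : Set G}

theorem notMem (h : IsSplitting p A v C O) {x : G} (hx : x ∈ C ∪ O) : x ∉ A ∧ x ≠ v :=
  h.union_eq.subset hx

theorem mem_of (h : IsSplitting p A v C O) {x : G} (hA : x ∉ A) (hx : x ≠ v) : x ∈ C ∨ x ∈ O :=
  h.union_eq.symm.subset ⟨hA, hx⟩

theorem mem_closure_of_nonempty {W W' : Set G} (hW : IsOpen W) (hW' : IsOpen W')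
    (hd : Disjoint W W') (hWW' : W ∪ W' = Aᶜ \ {v}) (hA : IsClosed A)
    (hAc : IsPreconnected Aᶜ) (hv : v ∉ A) (hn : W.Nonempty) : v ∈ closure W := by
  by_contra hcl
  have hvW : v ∉ W := fun h => hcl (subset_closure h)
  have hsub := hAc.subset_left_of_subset_union hW
    (hW'.union (isClosed_closure.isOpen_compl.inter hA.isOpen_compl))
    (disjoint_union_right.2 ⟨hd, disjoint_left.2 fun x hx hx' => hx'.1 (subset_closure hx)⟩)
    (fun x hx => ?_) ?_
  · exact hvW (hsub hv)
  · by_cases hxv : x = v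
    · exact Or.inr (Or.inr ⟨hxv ▸ hcl, hx⟩)
    · exact (hWW'.symm.subset ⟨hx, hxv⟩ : x ∈ W ∪ W').imp_right Or.inl
  · obtain ⟨x, hx⟩ := hn
    exact ⟨x, (hWW'.subset (Or.inl hx)).1, hx⟩

theorem isPreconnected_insert (h : IsSplitting p A v C O) (hA : IsClosed A)
    (hAc : IsPreconnected Aᶜ) (hv : v ∉ A) : IsPreconnected (insert v C) := by
  rcases C.eq_empty_or_nonempty with rfl | hn
  · simpa using isPreconnected_singleton
  · exact h.isPreconnected.subset_closure (subset_insert _ _) (insert_subset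
      (mem_closure_of_nonempty h.isOpen_left h.isOpen_right h.disjoint h.union_eq hA hAc hv hn)
      subset_closure)

theorem mem_closure_right (h : IsSplitting p A v C O) (hA : IsClosed A)
    (hAc : IsPreconnected Aᶜ) (hv : v ∉ A) (hn : O.Nonempty) : v ∈ closure O :=
  mem_closure_of_nonempty h.isOpen_right h.isOpen_left h.disjoint.symm
    (by rw [union_comm, h.union_eq]) hA hAc hv hn

theorem notMem_right (h : IsSplitting p A v C O) : p ∉ O := by
  intro hp
  rcases h.mem_or with h' | ⟨h', -⟩
  · exact disjoint_left.1 h.disjoint h' hp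
  · exact (h.notMem (Or.inr hp)).2 h'.symm

/-- Moving the separating point away from `p`. -/
theorem insert_subset_left {v₁ : G} {C₁ O₁ : Set G} (h : IsSplitting p A v C O)
    (h₁ : IsSplitting p A v₁ C₁ O₁) (hA : IsClosed A) (hAc : IsPreconnected Aᶜ) (hv : v ∉ A)
    (hv₁ : v₁ ∈ O) : insert v C ⊆ C₁ := by
  have hp : p ∈ C₁ := h₁.mem_or.resolve_right fun h' => h.notMem_right (h'.1 ▸ hv₁)
  have hvO := (h.notMem (Or.inr hv₁)).2
  refine (h.isPreconnected_insert hA hAc hv).subset_left_of_subset_union h₁.isOpen_left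
    h₁.isOpen_right h₁.disjoint ?_ ⟨p, h.mem_or.symm.imp (fun h' => h'.1.symm) id, hp⟩
  rw [h₁.union_eq]
  rintro x (rfl | hx)
  · exact ⟨hv, hvO.symm⟩
  · exact ⟨(h.notMem (Or.inl hx)).1, fun hxv => disjoint_left.1 h.disjoint hx (hxv ▸ hv₁)⟩

end IsSplitting

/-- A preconnected set meeting an open set `e`, and avoiding the rest of its closure, is contained
in `e`. -/
theorem subset_of_closure_inter_subset {W e : Set G} (hW : IsPreconnected W) (he : IsOpen e)
    (hWe : (W ∩ e).Nonempty) (hcl : W ∩ closure e ⊆ e) : W ⊆ e :=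
  hW.subset_left_of_subset_union he isClosed_closure.isOpen_compl
    (disjoint_left.2 fun _ hx hx' => hx' (subset_closure hx))
    (fun x hx => (em (x ∈ closure e)).imp (fun h => hcl ⟨hx, h⟩) id) hWe

namespace IsCellular

variable {V : Set G} {ℰ : Set (Set G)} {p v : G} {C O : Set G}

theorem aligned_left (h : IsCellular V ℰ) {A : Set G} (hA : Aligned ℰ A) (hv : v ∈ V)
    (hs : IsSplitting p A v C O) : Aligned ℰ C := by
  rintro e he ⟨x, hxe, hxC⟩
  obtain ⟨a, -, b, -, hab⟩ := h.exists_isEdge e he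
  refine hab.isPreconnected.subset_left_of_subset_union hs.isOpen_left hs.isOpen_right hs.disjoint
    ?_ ⟨x, hxe, hxC⟩
  rw [hs.union_eq]
  exact subset_sdiff_singleton (hA.compl e he ⟨x, hxe, (hs.notMem (Or.inl hxC)).1⟩)
    fun hve => disjoint_left.1 (h.disjoint_vertices e he) hve hv

theorem aligned_right (h : IsCellular V ℰ) {A : Set G} (hA : Aligned ℰ A) (hv : v ∈ V)
    (hs : IsSplitting p A v C O) : Aligned ℰ O := by
  rintro e he ⟨x, hxe, hxO⟩
  obtain ⟨a, -, b, -, hab⟩ := h.exists_isEdge e he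
  refine hab.isPreconnected.subset_left_of_subset_union hs.isOpen_right hs.isOpen_left
    hs.disjoint.symm ?_ ⟨x, hxe, hxO⟩
  rw [union_comm, hs.union_eq]
  exact subset_sdiff_singleton (hA.compl e he ⟨x, hxe, (hs.notMem (Or.inr hxO)).1⟩)
    fun hve => disjoint_left.1 (h.disjoint_vertices e he) hve hv

theorem edge_to_vertex_of_splitting [T2Space G] (h : IsCellular V ℰ) {A : Set G}
    (hAc : IsPreconnected Aᶜ)
    (hv : v ∈ V) (hvA : v ∉ A) (hs : IsSplitting p A v C O)
    (hO : ∀ e ∈ ℰ, e ⊆ O → ∀ a ∈ A, ∀ b ∈ V ∩ O, ¬ IsEdge e a b) {e : Set G} (he : e ∈ ℰ)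
    (heO : e ⊆ O) {a : G} (ha : a ∈ A) (hae : a ∈ closure e) : IsEdge e a v := by
  have hve : v ∉ e := fun hve => disjoint_left.1 (h.disjoint_vertices e he) hve hv
  obtain ⟨haV, b, hbV, hab⟩ := h.exists_isEdge_of_mem_closure he hae
    fun h' => (hs.notMem (Or.inr (heO h'))).1 ha
  by_cases hbv : b = v
  · rwa [← hbv]
  exfalso
  by_cases hbA : b ∈ A
  · have hsub := subset_of_closure_inter_subset hAc hab.isOpen (hab.nonempty.mono fun x hx =>
      ⟨(hs.notMem (Or.inr (heO hx))).1, hx⟩) (by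
        rw [hab.closure_eq]
        rintro x ⟨hx, rfl | rfl | hxe⟩
        exacts [absurd ha hx, absurd hbA hx, hxe])
    exact hve (hsub hvA)
  rcases hs.mem_of hbA hbv with hbC | hbO
  · obtain ⟨x, hxC, hxe⟩ := mem_closure_iff.1 hab.right_mem_closure C hs.isOpen_left hbC
    exact disjoint_left.1 hs.disjoint hxC (heO hxe)
  · exact hO e he heO a ha b ⟨hbV, hbO⟩ hab

theorem splitting_eq_sUnion_edges [T2Space G] (h : IsCellular V ℰ)
    (hcut : ∀ x : G, IsPreconnected ({x}ᶜ : Set G))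
    {A : Set G} (hA : Aligned ℰ A) (hAn : A.Nonempty)
    (hAc : IsPreconnected Aᶜ) (hv : v ∈ V) (hvA : v ∉ A) (hs : IsSplitting p A v C O)
    (hO : ∀ e ∈ ℰ, e ⊆ O → ∀ a ∈ A, ∀ b ∈ V ∩ O, ¬ IsEdge e a b) :
    O = ⋃ e ∈ {e ∈ ℰ | e ⊆ O ∧ ∃ a ∈ A, a ∈ closure e}, e := by
  set S := {e ∈ ℰ | e ⊆ O ∧ ∃ a ∈ A, a ∈ closure e} with hS
  have hSf : S.Finite := h.finite_edges.subset (sep_subset _ _)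
  have hcl : ∀ e ∈ S, closure e ∩ O = e := by
    rintro e ⟨he, heO, a, ha, hae⟩
    have hav := h.edge_to_vertex_of_splitting hAc hv hvA hs hO he heO ha hae
    refine Subset.antisymm ?_ fun x hx => ⟨subset_closure hx, heO hx⟩
    rw [hav.closure_eq]
    rintro x ⟨rfl | rfl | hx, hxO⟩
    · exact absurd ha (hs.notMem (Or.inr hxO)).1
    · exact absurd rfl (hs.notMem (Or.inr hxO)).2
    · exact hx
  let W := O \ ⋃ e ∈ S, e
  have hW : W = O \ ⋃ e ∈ S, closure e := by
    ext x
    simp only [W, mem_sdiff, mem_iUnion, exists_prop, not_exists, not_and]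
    refine and_congr_right fun hxO => forall₂_congr fun e he => not_congr ?_
    conv_lhs => rw [← hcl e he]
    exact ⟨fun hx => hx.1, fun hx => ⟨hx, hxO⟩⟩
  have hWo : IsOpen W := by
    rw [hW]
    exact hs.isOpen_right.sdiff (hSf.isClosed_biUnion fun _ _ => isClosed_closure)
  have hWal : Aligned ℰ W := by
    rintro e he ⟨x, hxe, hxO, hxS⟩ y hye
    refine ⟨h.aligned_right hA hv hs e he ⟨x, hxe, hxO⟩ hye, fun hyS => hxS ?_⟩
    simp only [mem_iUnion, exists_prop] at hyS ⊢
    obtain ⟨e', he', hye'⟩ := hyS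
    obtain rfl : e = e' := by
      by_contra hne
      exact disjoint_left.1 (h.pairwiseDisjoint he he'.1 hne) hye hye'
    exact ⟨e, he', hxe⟩
  have hWcl : IsClosed (insert v W) := by
    refine isClosed_of_closure_subset fun x hx => ?_
    rw [insert_eq, closure_union, closure_singleton] at hx
    rcases hx with hx | hx
    · exact Or.inl hx
    rcases h.mem_closure hWal hx with hx' | ⟨e, he, heW, hxe⟩
    · exact Or.inr hx'
    by_contra hxvW
    obtain ⟨hxv, hxW⟩ := not_or.1 hxvW
    by_cases hxA : x ∈ A
    · obtain ⟨y, hy⟩ := closure_nonempty_iff.1 ⟨x, hxe⟩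
      refine (heW hy).2 (mem_biUnion (x := e) ⟨he, heW.trans sdiff_subset, x, hxA, hxe⟩ hy)
    rcases hs.mem_of hxA hxv with hxC | hxO
    · obtain ⟨y, hyC, hyW⟩ := mem_closure_iff.1 hx C hs.isOpen_left hxC
      exact disjoint_left.1 hs.disjoint hyC hyW.1
    · refine hxW ⟨hxO, fun hxS => ?_⟩
      simp only [mem_iUnion, exists_prop] at hxS
      obtain ⟨e', he', hxe'⟩ := hxS
      obtain ⟨a, -, b, -, hab⟩ := h.exists_isEdge e' he'.1
      obtain ⟨y, hye, hyW⟩ := mem_closure_iff.1 hx e' hab.isOpen hxe'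
      exact hyW.2 (mem_biUnion he' hye)
  have hWempty : W = ∅ := by
    by_contra hne
    obtain ⟨a, ha⟩ := hAn
    have hsep : Separates v W (insert v W)ᶜ := by
      refine ⟨hWo, hWcl.isOpen_compl, disjoint_compl_right.mono_left (subset_insert v W),
        nonempty_iff_ne_empty.2 hne, ⟨a, ?_⟩, ?_⟩
      · rintro (rfl | haW)
        exacts [hvA ha, (hs.notMem (Or.inr haW.1)).1 ha]
      · ext x
        have : x ∈ W → x ≠ v := fun hx => (hs.notMem (Or.inr hx.1)).2
        simp only [mem_union, mem_compl_iff, mem_insert_iff, mem_singleton_iff]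
        tauto
    exact hsep.not_isPreconnected (hcut v)
  refine Subset.antisymm (sdiff_eq_empty.1 hWempty) (iUnion₂_subset fun e he => he.2.1)

end IsCellular

end Tangle

section TangleGrowth

variable {G : Type*} [TopologicalSpace G]

/-- There is a connected family in `ncSet univ` joining `A` to `B` whose members contain `A`, and
in which only the whole space contains `p`. -/
def Joins (p : G) (A : NonemptyCompacts G) (B : Set G) : Prop :=
  ∃ 𝒞 ⊆ ncSet (univ : Set G), IsPreconnected 𝒞 ∧ A ∈ 𝒞 ∧ (∃ B' ∈ 𝒞, (B' : Set G) = B) ∧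
    ∀ C ∈ 𝒞, (A : Set G) ⊆ C ∧ (p ∈ C → (C : Set G) = univ)

theorem Joins.trans {p : G} {A A' : NonemptyCompacts G} {B : Set G} (h : Joins p A A')
    (h' : Joins p A' B) : Joins p A B := by
  obtain ⟨𝒞, h1, h2, h3, ⟨A₁, h4, h5⟩, h6⟩ := h
  obtain rfl := SetLike.coe_injective h5
  obtain ⟨𝒟, k1, k2, k3, ⟨B', k4, k5⟩, k6⟩ := h'
  refine ⟨𝒞 ∪ 𝒟, union_subset h1 k1, h2.union A₁ h4 k3 k2, Or.inl h3, ⟨B', Or.inr k4, k5⟩, ?_⟩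
  rintro C (hC | hC)
  exacts [h6 C hC, ⟨(h6 A₁ h4).1.trans (k6 C hC).1, (k6 C hC).2⟩]

namespace IsCellular

variable [T2Space G] {V : Set G} {ℰ : Set (Set G)} {p v : G} {C O : Set G}

theorem joins_of_edges (h : IsCellular V ℰ) (hcut : ∀ x : G, IsPreconnected ({x}ᶜ : Set G))
    {A : NonemptyCompacts G} (hA : Aligned ℰ (A : Set G)) (hAN : A ∈ ncSet (univ : Set G))
    (hv : v ∈ V) (hvA : v ∉ A) (hs : IsSplitting p (A : Set G) v C O) (hOn : O.Nonempty)
    (hO : ∀ e ∈ ℰ, e ⊆ O → ∀ a ∈ A, ∀ b ∈ V ∩ O, ¬ IsEdge e a b) : Joins p A Cᶜ := by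
  have hAc : IsPreconnected (A : Set G)ᶜ := by
    rw [compl_eq_univ_sdiff]
    exact hAN.2.2
  have hAcl : IsClosed (A : Set G) := A.isCompact.isClosed
  set S := {e ∈ ℰ | e ⊆ O ∧ ∃ a ∈ (A : Set G), a ∈ closure e} with hS
  have hSf : S.Finite := h.finite_edges.subset (sep_subset _ _)
  have hOS : O = ⋃ e ∈ S, e :=
    h.splitting_eq_sUnion_edges hcut hA A.nonempty hAc hv hvA hs hO
  have hex : ∀ e : Set G, ∃ g : C(unitInterval, G), e ∈ S →
      Function.Injective g ∧ g 0 ∈ A ∧ g 1 = v ∧ g '' Ioo 0 1 = e := by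
    intro e
    by_cases he : e ∈ S
    · obtain ⟨he, heO, a, ha, hae⟩ := he
      obtain ⟨g, hg, rfl, h1, h2⟩ := (h.edge_to_vertex_of_splitting hAc hv hvA hs hO he heO ha
        hae).exists_path
      exact ⟨g, fun _ => ⟨hg, ha, h1, h2⟩⟩
    · exact ⟨ContinuousMap.const _ v, fun h => absurd h he⟩
  choose g hg using hex
  obtain ⟨F, hF, hFt⟩ := exists_sweep A hAN.2.1 hSf g fun e he => (hg e he).2.1
  have hmemF : ∀ t x, x ∈ F t ↔ x ∈ A ∨ ∃ e ∈ S, ∃ s ≤ t, g e s = x := by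
    intro t x
    rw [← SetLike.mem_coe, (hFt t).2]
    simp
  have hcases : ∀ s : unitInterval, s = 0 ∨ s = 1 ∨ s ∈ Ioo (0 : unitInterval) 1 := by
    intro s
    have := Icc_eq_insert_Ioo.subset (mem_univ s)
    simpa only [mem_insert_iff] using this
  have hIoo : ∀ e ∈ S, ∀ s ∈ Ioo (0 : unitInterval) 1, g e s ∈ e := fun e he s hs =>
    (hg e he).2.2.2.subset (mem_image_of_mem _ hs)
  have hF0 : F 0 = A := by
    apply SetLike.coe_injective
    ext x
    rw [SetLike.mem_coe, hmemF]
    refine ⟨?_, Or.inl⟩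
    rintro (hx | ⟨e, he, s, hs, rfl⟩)
    · exact hx
    · rw [le_antisymm hs unitInterval.nonneg']
      exact (hg e he).2.1
  have hOF : ∀ x ∈ O, ∃ e ∈ S, ∃ s ∈ Ioo (0 : unitInterval) 1, g e s = x := by
    intro x hx
    rw [hOS] at hx
    simp only [mem_iUnion, exists_prop] at hx
    obtain ⟨e, he, hxe⟩ := hx
    rw [← (hg e he).2.2.2] at hxe
    exact ⟨e, he, hxe⟩
  have hCF : ∀ t, ∀ x ∈ C, x ∉ F t := by
    intro t x hxC hx
    rw [hmemF] at hx
    rcases hx with hx | ⟨e, he, s, hs', rfl⟩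
    · exact (hs.notMem (Or.inl hxC)).1 hx
    · rcases hcases s with rfl | rfl | hs''
      · exact (hs.notMem (Or.inl hxC)).1 (hg e he).2.1
      · exact (hs.notMem (Or.inl hxC)).2 (hg e he).2.2.1
      · exact disjoint_left.1 hs.disjoint hxC (he.2.1 (hIoo e he s hs''))
  have hF1 : (F 1 : Set G) = Cᶜ := by
    refine Subset.antisymm (fun x hx hxC => hCF 1 x hxC hx) fun x hxC => ?_
    rw [SetLike.mem_coe, hmemF]
    by_contra! hcon
    rcases eq_or_ne x v with rfl | hxv
    · obtain ⟨y, hy⟩ := hOn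
      obtain ⟨e, he, -⟩ := hOF y hy
      exact hcon.2 e he 1 le_rfl (hg e he).2.2.1
    · obtain ⟨e, he, s, -, hsx⟩ := hOF x ((hs.mem_of hcon.1 hxv).resolve_left hxC)
      exact hcon.2 e he s unitInterval.le_one' hsx
  have hvF : ∀ t, v ∈ F t → t = 1 := by
    intro t hvt
    rw [hmemF] at hvt
    rcases hvt with hvA' | ⟨e, he, s, hst, hsv⟩
    · exact absurd hvA' hvA
    · obtain rfl := (hg e he).1 (hsv.trans (hg e he).2.2.1.symm)
      exact le_antisymm unitInterval.le_one' hst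
  refine ⟨range F, ?_, isPreconnected_range hF, ⟨0, hF0⟩, ⟨F 1, ⟨1, rfl⟩, hF1⟩, ?_⟩
  · rintro _ ⟨t, rfl⟩
    refine ⟨subset_univ _, (hFt t).1, ?_⟩
    rw [← compl_eq_univ_sdiff]
    by_cases ht : t = 1
    · rw [ht, hF1, compl_compl]
      exact hs.isPreconnected
    have ht1 : t < 1 := lt_of_le_of_ne unitInterval.le_one' ht
    have heq : (F t : Set G)ᶜ = insert v C ∪ ⋃ e ∈ S, g e '' Ioi t := by
      ext x
      constructor
      · intro hx
        rw [mem_compl_iff, SetLike.mem_coe, hmemF] at hx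
        push Not at hx
        by_cases hxv : x = v
        · exact Or.inl (Or.inl hxv)
        rcases hs.mem_of hx.1 hxv with hxC | hxO
        · exact Or.inl (Or.inr hxC)
        · obtain ⟨e, he, s, -, hsx⟩ := hOF x hxO
          exact Or.inr (mem_biUnion he ⟨s, not_le.1 fun hst => hx.2 e he s hst hsx, hsx⟩)
      · rintro ((rfl | hx) | hx) hxt
        · exact ht (hvF t hxt)
        · exact hCF t x hx hxt
        · simp only [mem_iUnion, exists_prop] at hx
          obtain ⟨e, he, s, hst, rfl⟩ := hx
          rcases hcases s with rfl | rfl | hs'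
          · exact absurd (mem_Ioi.1 hst) (not_lt.2 unitInterval.nonneg')
          · exact ht (hvF t ((hg e he).2.2.1 ▸ hxt))
          · rw [SetLike.mem_coe, hmemF] at hxt
            rcases hxt with hxA | ⟨e', he', s', hs't, heq⟩
            · exact (hs.notMem (Or.inr (he.2.1 (hIoo e he s hs')))).1 hxA
            · rcases hcases s' with rfl | rfl | hs''
              · exact (hs.notMem (Or.inr (he.2.1 (hIoo e he s hs')))).1 (heq ▸ (hg e' he').2.1)
              · exact not_le.2 ht1 hs't
              · obtain rfl : e = e' := by
                  by_contra hne
                  exact disjoint_left.1 (h.pairwiseDisjoint he.1 he'.1 hne) (hIoo e he s hs')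
                    (heq ▸ hIoo e' he' s' hs'')
                obtain rfl := (hg e he).1 heq
                exact not_le.2 (mem_Ioi.1 hst) hs't
    rw [heq]
    have hpre : ∀ X ∈ insert (insert v C) ((fun e => g e '' Ioi t) '' S),
        v ∈ X ∧ IsPreconnected X := by
      rintro X (rfl | ⟨e, he, rfl⟩)
      · exact ⟨mem_insert _ _, hs.isPreconnected_insert hAcl hAc hvA⟩
      · exact ⟨⟨1, ht1, (hg e he).2.2.1⟩,
          isPreconnected_Ioi.image _ (g e).continuous.continuousOn⟩
    have := isPreconnected_sUnion v _ (fun X hX => (hpre X hX).1) fun X hX => (hpre X hX).2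
    rwa [sUnion_insert, sUnion_image] at this
  · rintro _ ⟨t, rfl⟩
    refine ⟨fun x hx => (hmemF t x).2 (Or.inl hx), fun hp => ?_⟩
    rcases hs.mem_or with hpC | ⟨rfl, rfl⟩
    · exact absurd hp (hCF t p hpC)
    · rw [hvF t hp, hF1, compl_empty]

theorem joins_of_isSplitting [CompactSpace G] [LocallyConnectedSpace G] (h : IsCellular V ℰ)
    (hcut : ∀ x : G, IsPreconnected ({x}ᶜ : Set G)) (hp : p ∈ V) (n : ℕ) :
    ∀ (A : NonemptyCompacts G) (v : G) (C O : Set G), Aligned ℰ (A : Set G) →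
      A ∈ ncSet (univ : Set G) → v ∈ V → v ∉ A → p ∉ A → IsSplitting p (A : Set G) v C O →
      O.Nonempty → (V ∩ O).ncard < n → Joins p A Cᶜ := by
  induction n with
  | zero => intro _ _ _ _ _ _ _ _ _ _ _ hn; exact absurd hn (Nat.not_lt_zero _)
  | succ n ih =>
    intro A v C O hA hAN hv hvA hpA hs hOn hn
    by_cases hO : ∀ e ∈ ℰ, e ⊆ O → ∀ a ∈ A, ∀ b ∈ V ∩ O, ¬ IsEdge e a b
    · exact h.joins_of_edges hcut hA hAN hv hvA hs hOn hO
    push Not at hO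
    obtain ⟨e, he, heO, a, ha, v₁, hv₁, hav⟩ := hO
    have hAc : IsPreconnected (A : Set G)ᶜ := by
      rw [compl_eq_univ_sdiff]
      exact hAN.2.2
    have hAcl : IsClosed (A : Set G) := A.isCompact.isClosed
    obtain ⟨C₁, O₁, hs₁⟩ := exists_isSplitting (v := v₁) hAcl hpA
    have hv₁A : v₁ ∉ A := (hs.notMem (Or.inr hv₁.2)).1
    have hsub : insert v C ⊆ C₁ := hs.insert_subset_left hs₁ hAcl hAc hvA hv₁.2
    have hp₁ : p ∈ C₁ := hsub (hs.mem_or.symm.imp (fun h' => h'.1.symm) id)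
    have hv₁C₁ : v₁ ∉ C₁ := fun h' => (hs₁.notMem (Or.inl h')).2 rfl
    have hO₁ : O₁ ⊆ O := fun x hx => by
      have hxC₁ := disjoint_right.1 hs₁.disjoint hx
      exact (hs.mem_of (hs₁.notMem (Or.inr hx)).1
        (by rintro rfl; exact hxC₁ (hsub (mem_insert _ _)))).resolve_left
          fun hxC => hxC₁ (hsub (Or.inr hxC))
    have hv₁O₁ : v₁ ∉ O₁ := fun h' => (hs₁.notMem (Or.inr h')).2 rfl
    have hlt : ∀ X ⊆ O, v₁ ∉ X → (V ∩ X).ncard < n := fun X hX hvX =>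
      lt_of_lt_of_le (ncard_lt_ncard ⟨inter_subset_inter_right _ hX, fun h' => hvX (h' hv₁).2⟩
        (h.finite_vertices.subset inter_subset_left)) (Nat.lt_succ_iff.1 hn)
    have hO₁n : O₁.Nonempty := by
      obtain ⟨y, hy⟩ := hav.nonempty
      refine ⟨y, (hs₁.mem_of (hs.notMem (Or.inr (heO hy))).1 ?_).resolve_left fun hyC => ?_⟩
      · rintro rfl
        exact disjoint_left.1 (h.disjoint_vertices e he) hy hv₁.1
      · have := subset_of_closure_inter_subset hs₁.isPreconnected hav.isOpen ⟨y, hyC, hy⟩ (by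
          rw [hav.closure_eq]
          rintro x ⟨hx, rfl | rfl | hxe⟩
          exacts [absurd ha (hs₁.notMem (Or.inl hx)).1, absurd hx hv₁C₁, hxe])
        exact disjoint_left.1 (h.disjoint_vertices e he) (this hp₁) hp
    have hj₁ := ih A v₁ C₁ O₁ hA hAN hv₁.1 hv₁A hpA hs₁ hO₁n (hlt O₁ hO₁ hv₁O₁)
    obtain ⟨A₂, hA₂N, hA₂⟩ : ∃ A₂ ∈ ncSet (univ : Set G), (A₂ : Set G) = C₁ᶜ := by
      obtain ⟨𝒞, h1, -, -, ⟨A₂, h4, h5⟩, -⟩ := hj₁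
      exact ⟨A₂, h1 h4, h5⟩
    rw [← hA₂] at hj₁
    have hvA₂ : v ∉ A₂ := by
      rw [← SetLike.mem_coe, hA₂]
      exact not_not.2 (hsub (mem_insert _ _))
    have hpA₂ : p ∉ A₂ := by
      rw [← SetLike.mem_coe, hA₂]
      exact not_not.2 hp₁
    refine hj₁.trans (ih A₂ v C (C₁ ∩ O) ?_ hA₂N hv hvA₂ hpA₂ ⟨hs.isOpen_left,
      hs₁.isOpen_left.inter hs.isOpen_right, hs.disjoint.mono_right inter_subset_right, ?_,
      hs.isPreconnected, hs.mem_or⟩ ?_ (hlt _ inter_subset_right fun h' => hv₁C₁ h'.1))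
    · rw [hA₂]
      exact (h.aligned_left hA hv₁.1 hs₁).compl
    · rw [hA₂, compl_compl]
      ext x
      constructor
      · rintro (hx | hx)
        · exact ⟨hsub (Or.inr hx), (hs.notMem (Or.inl hx)).2⟩
        · exact ⟨hx.1, (hs.notMem (Or.inr hx.2)).2⟩
      · rintro ⟨hx, hxv⟩
        exact (hs.mem_of (hs₁.notMem (Or.inl hx)).1 hxv).imp_right fun hxO => ⟨hx, hxO⟩
    · exact mem_closure_iff.1 (hs.mem_closure_right hAcl hAc hvA hOn) C₁ hs₁.isOpen_left
        (hsub (mem_insert _ _))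

end IsCellular

end TangleGrowth

theorem IsCellular.aligned_of_frontier_subset {G : Type*} [TopologicalSpace G] {V : Set G}
    {ℰ : Set (Set G)} (h : IsCellular V ℰ) {A : Set G} (hA : frontier A ⊆ V) :
    IsCellular.Aligned ℰ A := by
  intro e he hne
  obtain ⟨a, -, b, -, hab⟩ := h.exists_isEdge e he
  have hd : ∀ x ∈ e, x ∉ frontier A := fun x hx hxA =>
    disjoint_left.1 (h.disjoint_vertices e he) hx (hA hxA)
  have hint : ∀ x ∈ e, x ∈ closure A → x ∈ interior A := fun x hx hxA =>
    by_contra fun hxi => hd x hx ⟨hxA, hxi⟩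
  refine (hab.isPreconnected.subset_left_of_subset_union isOpen_interior
    isClosed_closure.isOpen_compl (disjoint_left.2 fun x hx hx' =>
      hx' (subset_closure (interior_subset hx))) (fun x hx => ?_) ?_).trans interior_subset
  · exact (em (x ∈ closure A)).imp (hint x hx) id
  · obtain ⟨x, hx, hxA⟩ := hne
    exact ⟨x, hx, hint x hx (subset_closure hxA)⟩


section Frontier

variable {G : Type*} [TopologicalSpace G] [T2Space G]

theorem IsEdge.finite_inter_frontier {e A : Set G} {x y : G} (he : IsEdge e x y)
    (hA : IsClosed A) (hAc : IsPreconnected Aᶜ) : (e ∩ frontier A).Finite := by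
  obtain ⟨g, hg, -, -, rfl⟩ := he.exists_path
  rw [← image_preimage_eq_of_subset (f := g) (s := g '' Ioo 0 1 ∩ frontier A)
    (inter_subset_left.trans (image_subset_range _ _))]
  refine Finite.image _ (not_infinite.1 fun hinf => ?_)
  have hgo : ∀ a ∈ Ioo (0 : unitInterval) 1, ∀ b ∈ Ioo (0 : unitInterval) 1,
      IsOpen (g '' Ioo a b) := by
    intro a ha b hb
    have heq : g '' Ioo a b = g '' Ioo 0 1 \ g '' (Icc 0 a ∪ Icc b 1) := by
      rw [← image_sdiff hg]
      congr 1
      ext t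
      simp only [mem_Ioo, mem_sdiff, mem_union, mem_Icc, not_or, not_and, not_le]
      constructor
      · rintro ⟨h1, h2⟩
        exact ⟨⟨ha.1.trans h1, h2.trans hb.2⟩, fun _ => h1, fun h => absurd h (not_le.2 h2)⟩
      · rintro ⟨h1, h2, h3⟩
        refine ⟨h2 h1.1.le, ?_⟩
        by_contra! h
        exact absurd (h3 h) (not_lt.2 h1.2.le)
    rw [heq]
    exact he.isOpen.sdiff ((isClosed_Icc.union isClosed_Icc).isCompact.image g.continuous).isClosed
  obtain ⟨s, hs, hcard⟩ := hinf.exists_subset_card_eq 5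
  let f := s.orderEmbOfFin hcard
  have hf : ∀ i, f i ∈ Ioo (0 : unitInterval) 1 ∧ g (f i) ∈ frontier A := by
    intro i
    obtain ⟨⟨t, ht, hti⟩, hfr⟩ := hs (s.orderEmbOfFin_mem hcard i)
    exact ⟨hg hti ▸ ht, hfr⟩
  have key : ∀ i j k : Fin 5, i < j → j < k → Aᶜ ⊆ g '' Ioo (f i) (f k) := by
    intro i j k hij hjk
    have hik : f i ≠ f k := (f.strictMono (hij.trans hjk)).ne
    refine subset_of_closure_inter_subset hAc (hgo _ (hf i).1 _ (hf k).1) ?_ ?_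
    · have hcl : g (f j) ∈ closure Aᶜ := by
        have := (hf j).2
        rw [frontier_eq_closure_inter_closure] at this
        exact this.2
      rw [inter_comm]
      exact mem_closure_iff.1 hcl _ (hgo _ (hf i).1 _ (hf k).1)
        (mem_image_of_mem _ ⟨f.strictMono hij, f.strictMono hjk⟩)
    · rw [← image_closure_of_isCompact isClosed_closure.isCompact g.continuous.continuousOn,
        closure_Ioo hik]
      rintro _ ⟨hx, t, ht, rfl⟩
      have hmem : ∀ i, g (f i) ∈ A := fun i => hA.frontier_subset (hf i).2
      refine ⟨t, ⟨lt_of_le_of_ne ht.1 ?_, lt_of_le_of_ne ht.2 ?_⟩, rfl⟩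
      · rintro rfl; exact hx (hmem i)
      · rintro rfl; exact hx (hmem k)
  obtain ⟨z, hz⟩ : (Aᶜ).Nonempty := by
    refine nonempty_compl.2 fun hA' => ?_
    have := (hf 0).2
    simp [hA'] at this
  obtain ⟨t, ht, rfl⟩ := key 0 1 2 (by decide) (by decide) hz
  obtain ⟨t', ht', htt'⟩ := key 2 3 4 (by decide) (by decide) hz
  rw [hg htt'] at ht'
  exact lt_asymm ht.2 ht'.1

theorem _root_.IsFiniteGraph.finite_frontier (h : IsFiniteGraph G) {A : Set G} (hA : IsClosed A)
    (hAc : IsPreconnected Aᶜ) : (frontier A).Finite := by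
  obtain ⟨V, ℰ, -, hc⟩ := h.exists_isCellular finite_empty
  refine (hc.finite_vertices.union (hc.finite_edges.biUnion (t := fun e => e ∩ frontier A)
    fun e he => ?_)).subset fun x hx => ?_
  · obtain ⟨a, -, b, -, hab⟩ := hc.exists_isEdge e he
    exact hab.finite_inter_frontier hA hAc
  · exact (hc.mem_or x).imp_right fun ⟨e, he, hxe⟩ => mem_biUnion he ⟨hxe, hx⟩

theorem grows_top_of_notMem [CompactSpace G] [LocallyConnectedSpace G] [ConnectedSpace G]
    (h : IsTangle G) {A : NonemptyCompacts G} (hA : A ∈ ncSet (univ : Set G)) {p : G}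
    (hp : p ∉ A) : Grows ⊤ {p} A := by
  have hAcl : IsClosed (A : Set G) := A.isCompact.isClosed
  have hAc : IsPreconnected (A : Set G)ᶜ := by
    rw [compl_eq_univ_sdiff]
    exact hA.2.2
  obtain ⟨V, ℰ, hV, hc⟩ := h.1.exists_isCellular
    ((finite_singleton p).union (h.1.finite_frontier hAcl hAc))
  obtain ⟨hpV, hfr⟩ := union_subset_iff.1 hV
  rw [singleton_subset_iff] at hpV
  have hs : IsSplitting p (A : Set G) p ∅ ((A : Set G)ᶜ \ {p}) :=
    ⟨isOpen_empty, hAcl.isOpen_compl.sdiff isClosed_singleton, empty_disjoint _, empty_union _,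
      isPreconnected_empty, Or.inr ⟨rfl, rfl⟩⟩
  have hn : ((A : Set G)ᶜ \ {p}).Nonempty := by
    by_contra hn
    have hAp : (A : Set G)ᶜ = {p} :=
      Subset.antisymm (sdiff_eq_empty.1 (not_nonempty_iff_eq_empty.1 hn))
        (singleton_subset_iff.2 hp)
    rcases isClopen_iff.1 ⟨isClosed_singleton, hAp ▸ hAcl.isOpen_compl⟩ with h' | h'
    · exact singleton_ne_empty _ h'
    · rw [h', compl_univ_iff] at hAp
      exact A.nonempty.ne_empty hAp
  obtain ⟨𝒞, h1, h2, h3, ⟨B, h4, h5⟩, h6⟩ := hc.joins_of_isSplitting h.2 hpV _ A p ∅ _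
    (hc.aligned_of_frontier_subset hfr) hA hpV hp hp hs hn (Nat.lt_succ_self _)
  have htop : ∀ C : NonemptyCompacts G, (C : Set G) = univ → C = ⊤ := fun C hC =>
    SetLike.coe_injective (by rw [hC, NonemptyCompacts.coe_top])
  refine ⟨𝒞, by simpa using h1, h2, h3, htop B (by rw [h5, compl_empty]) ▸ h4, fun C hC =>
    ⟨(h6 C hC).1, ?_⟩⟩
  rintro _ rfl hpC -
  exact htop C ((h6 C hC).2 hpC)

theorem grows_top [CompactSpace G] [LocallyConnectedSpace G] [ConnectedSpace G]
    (h : IsTangle G) {A : NonemptyCompacts G} (hA : A ∈ ncSet (univ : Set G)) (p : G) :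
    Grows ⊤ {p} A := by
  by_cases hp : p ∈ A
  · by_cases hA' : A = ⊤
    · subst hA'
      refine ⟨{⊤}, by simpa using hA, isPreconnected_singleton, rfl, rfl, ?_⟩
      rintro _ rfl
      exact ⟨Subset.rfl, fun _ _ _ _ => rfl⟩
    · obtain ⟨q, hq⟩ : ∃ q, q ∉ A := by
        by_contra! hcon
        exact hA' (SetLike.coe_injective (by
          rw [NonemptyCompacts.coe_top]; exact eq_univ_of_forall hcon))
      exact (grows_top_of_notMem h hA hq).of_subset
        (singleton_subset_iff.2 (Or.inr hp))
  · exact grows_top_of_notMem h hA hp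

theorem grows_of_isTangle {X : NonemptyCompacts G} (hX : IsTangle (X : Set G))
    (hXc : IsPreconnected (X : Set G)) {A : NonemptyCompacts G} (hA : A ∈ ncSet (X : Set G))
    {p : G} (hp : p ∈ X) : Grows X {p} A := by
  have : CompactSpace (X : Set G) := isCompact_iff_compactSpace.1 X.isCompact
  have : ConnectedSpace (X : Set G) := isConnected_iff_connectedSpace.1 ⟨X.nonempty, hXc⟩
  have : LocallyConnectedSpace (X : Set G) := hX.1.locallyConnectedSpace
  have hi : Topology.IsInducing (Subtype.val : ↥(X : Set G) → G) := .subtypeVal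
  have hcont : Continuous (Subtype.val : ↥(X : Set G) → G) := continuous_subtype_val
  let A' : NonemptyCompacts (X : Set G) :=
    ⟨⟨Subtype.val ⁻¹' (A : Set G), (A.isCompact.isClosed.preimage hcont).isCompact⟩, by
      obtain ⟨x, hx⟩ := A.nonempty
      exact ⟨⟨x, hA.1 hx⟩, hx⟩⟩
  let φ : NonemptyCompacts (X : Set G) → NonemptyCompacts G := fun B => B.map _ hcont
  have hφ : ∀ B, (φ B : Set G) = Subtype.val '' (B : Set (X : Set G)) := fun B => rfl
  have hφA : φ A' = A := by
    apply SetLike.coe_injective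
    rw [hφ]
    exact (Subtype.image_preimage_coe _ _).trans (inter_eq_right.2 hA.1)
  have hφX : φ ⊤ = X := by
    apply SetLike.coe_injective
    rw [hφ, NonemptyCompacts.coe_top, image_univ, Subtype.range_coe]
  have hmem : ∀ B, φ B ∈ ncSet (X : Set G) ↔ B ∈ ncSet (univ : Set (X : Set G)) := by
    intro B
    have h1 : (φ B : Set G) ⊆ X := by
      rw [hφ]
      exact (image_subset_range _ _).trans_eq Subtype.range_coe
    have h2 : (X : Set G) \ φ B = Subtype.val '' (univ \ (B : Set (X : Set G))) := by
      rw [image_sdiff Subtype.val_injective, image_univ, Subtype.range_coe, hφ]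
    change _ ∧ _ ∧ _ ↔ _ ∧ _ ∧ _
    rw [h2, hφ, hi.isPreconnected_image, hi.isPreconnected_image]
    simp [← hφ, h1]
  obtain ⟨𝒞, h1, h2, h3, h4, h5⟩ := grows_top hX ((hmem A').1 (hφA ▸ hA)) ⟨p, hp⟩
  rw [NonemptyCompacts.coe_top] at h1
  refine ⟨φ '' 𝒞, ?_, h2.image _ hcont.nonemptyCompacts_map.continuousOn,
    ⟨A', h3, hφA⟩, ⟨⊤, h4, hφX⟩, ?_⟩
  · rintro _ ⟨B, hB, rfl⟩
    exact (hmem B).2 (h1 hB)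
  · rintro _ ⟨B, hB, rfl⟩
    refine ⟨?_, ?_⟩
    · rw [← hφA, hφ, hφ]
      exact image_mono (h5 B hB).1
    · rintro _ rfl hpB hpA
      rw [← hφX, (h5 B hB).2 _ rfl ?_ hpA]
      obtain ⟨x, hx, rfl⟩ := (hφ B).subset hpB
      exact hx

end Frontier

section Dumbbell

variable {G : Type*} [TopologicalSpace G]

theorem grows_piece [T2Space G] {X : NonemptyCompacts G} {p : G}
    (hX : (X : Set G) = {p} ∨ IsTangle (X : Set G)) (hXc : IsPreconnected (X : Set G)) (hp : p ∈ X)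
    {A : NonemptyCompacts G} (hA : A ∈ ncSet (X : Set G)) : Grows X {p} A := by
  rcases hX with hX | hX
  · have hAX : A = X := SetLike.coe_injective (by
      rw [hX, ← A.nonempty.subset_singleton_iff, ← hX]
      exact hA.1)
    subst hAX
    refine ⟨{A}, by simpa using hA, isPreconnected_singleton, rfl, rfl, ?_⟩
    rintro _ rfl
    exact ⟨Subset.rfl, fun _ _ _ _ => rfl⟩
  · exact grows_of_isTangle hX hXc hA hp

theorem _root_.IsTangle.isPreconnected_sdiff {X : Set G} (hX : IsTangle X) {p : G} (hp : p ∈ X) :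
    IsPreconnected (X \ {p}) := by
  have := (hX.2 ⟨p, hp⟩).image _ continuous_subtype_val.continuousOn
  rwa [compl_eq_univ_sdiff, image_sdiff Subtype.val_injective, image_univ, Subtype.range_coe,
    image_singleton] at this

theorem isPreconnected_piece_sdiff {X : Set G} {p : G} (hX : X = {p} ∨ IsTangle X) (hp : p ∈ X) :
    IsPreconnected (X \ {p}) := by
  rcases hX with rfl | hX
  · simp [isPreconnected_empty]
  · exact hX.isPreconnected_sdiff hp

theorem isCompact_piece {X : Set G} {p : G} (hX : X = {p} ∨ IsTangle X) : IsCompact X := by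
  rcases hX with rfl | hX
  · exact isCompact_singleton
  · exact isCompact_iff_compactSpace.2 hX.1.compactSpace

theorem isPreconnected_image_Iio (g : C(unitInterval, G)) : IsPreconnected (g '' Iio 1) :=
  isPreconnected_Iio.image _ g.continuous.continuousOn

theorem grows_sup_arcOrPoint [T2Space G] {K L : NonemptyCompacts G} {p q : G}
    (hK : (K : Set G) = {p} ∨ IsTangle (K : Set G)) (hKc : IsPreconnected (K : Set G))
    (hL : IsArcOrPoint (L : Set G) p q) (hKL : (K : Set G) ∩ L = {p}) :
    IsPreconnected (((K ⊔ L : NonemptyCompacts G) : Set G) \ {q}) ∧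
      ∀ A ∈ ncSet ((K ⊔ L : NonemptyCompacts G) : Set G), Grows (K ⊔ L) {q} A := by
  have hpKL : p ∈ (K : Set G) ∩ L := hKL ▸ mem_singleton p
  rcases hL with ⟨hL, rfl⟩ | ⟨g, hg, rfl, rfl, hL⟩
  · have hKL' : K ⊔ L = K := sup_eq_left.2 (by
      change (L : Set G) ⊆ K
      rw [hL]
      exact singleton_subset_iff.2 hpKL.1)
    rw [hKL']
    exact ⟨isPreconnected_piece_sdiff hK hpKL.1, fun A hA => grows_piece hK hKc hpKL.1 hA⟩
  have h01 : g 0 ≠ g 1 := hg.ne zero_ne_one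
  have h1K : g 1 ∉ (K : Set G) := fun h =>
    h01 (hKL.subset ⟨h, hL.subset (mem_range_self 1)⟩ : g 1 = g 0).symm
  have hsd : ∀ t, (L : Set G) \ {g t} = g '' {t}ᶜ := fun t => by
    rw [← hL, ← image_univ, ← image_singleton, ← image_sdiff hg, compl_eq_univ_sdiff]
  have h0 : ({0}ᶜ : Set unitInterval) = Ioi 0 := by
    ext t
    exact unitInterval.pos_iff_ne_zero.symm
  have h1 : ({1}ᶜ : Set unitInterval) = Iio 1 := by
    ext t
    exact unitInterval.lt_one_iff_ne_one.symm
  have hLc : IsPreconnected (L : Set G) := hL ▸ isPreconnected_range g.continuous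
  constructor
  · rw [NonemptyCompacts.coe_sup, union_sdiff_distrib, sdiff_singleton_eq_self h1K, hsd, h1]
    exact hKc.union _ hpKL.1 (mem_image_of_mem g (mem_Iio.2 zero_lt_one))
      (isPreconnected_image_Iio g)
  · intro A hA
    refine Grows.sup hKL hKc hLc (isPreconnected_piece_sdiff hK hpKL.1) ?_ ?_ ?_
      (fun A hA => grows_piece hK hKc hpKL.1 hA) (fun A hA => grows_arc hg hL.symm hA) ?_ hA
    · rw [hsd, h0]
      exact isPreconnected_Ioi.image _ g.continuous.continuousOn
    · exact singleton_subset_iff.2 (hL.subset (mem_range_self 1))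
    · exact h01
    · exact fun A hA h => singleton_subset_iff.2 (mem_of_notMem_arc hg hL.symm hA h)

theorem isPreconnected_ncSet_of_grows [CompactSpace G] [Nonempty G]
    (h : ∀ A ∈ ncSet (univ : Set G), ∃ P, Grows ⊤ P A) : IsPreconnected (ncSet (univ : Set G)) := by
  refine isPreconnected_of_forall ⊤ fun A hA => ?_
  obtain ⟨P, 𝒞, h1, h2, h3, h4, -⟩ := h A hA
  exact ⟨𝒞, by simpa using h1, h4, h3, h2⟩

theorem IsArcOrPoint.isCompact {L : Set G} {p q : G} (h : IsArcOrPoint L p q) : IsCompact L := by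
  rcases h with ⟨rfl, -⟩ | ⟨g, -, -, -, rfl⟩
  exacts [isCompact_singleton, isCompact_range g.continuous]

theorem IsDumbbell.isPreconnected_ncSet [T2Space G] [CompactSpace G] [ConnectedSpace G]
    {K L M : Set G} {p q : G} (h : IsDumbbell K L M p q) :
    IsPreconnected (ncSet (univ : Set G)) := by
  obtain ⟨hK, hM, hL, hKL, hKLM, huniv⟩ := h
  have hp : p ∈ K ∩ L := hKL ▸ mem_singleton p
  have hq : q ∈ (K ∪ L) ∩ M := hKLM ▸ mem_singleton q
  obtain ⟨K, rfl⟩ : ∃ X : NonemptyCompacts G, (X : Set G) = K :=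
    ⟨⟨⟨K, isCompact_piece hK⟩, p, hp.1⟩, rfl⟩
  obtain ⟨L, rfl⟩ : ∃ X : NonemptyCompacts G, (X : Set G) = L :=
    ⟨⟨⟨L, hL.isCompact⟩, p, hp.2⟩, rfl⟩
  obtain ⟨M, rfl⟩ : ∃ X : NonemptyCompacts G, (X : Set G) = M :=
    ⟨⟨⟨M, isCompact_piece hM⟩, q, hq.2⟩, rfl⟩
  have hcl : ∀ X : NonemptyCompacts G, IsClosed (X : Set G) := fun X => X.isCompact.isClosed
  have huniv' : univ ⊆ (K : Set G) ∪ L ∪ M := huniv.symm.subset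
  have hKLc : IsPreconnected ((K : Set G) ∪ L) := by
    simpa using isPreconnected_inter_of_inter_eq_singleton ((hcl K).union (hcl L)) (hcl M) hKLM
      isPreconnected_univ huniv'
  have hMc : IsPreconnected (M : Set G) := by
    simpa using isPreconnected_inter_of_inter_eq_singleton (hcl M) ((hcl K).union (hcl L))
      (by rwa [inter_comm]) isPreconnected_univ (by rwa [union_comm])
  have hKc : IsPreconnected (K : Set G) := by
    simpa [union_inter_cancel_left] using
      isPreconnected_inter_of_inter_eq_singleton (hcl K) (hcl L) hKL hKLc Subset.rfl
  obtain ⟨h1, h2⟩ := grows_sup_arcOrPoint hK hKc hL hKL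
  have htop : K ⊔ L ⊔ M = ⊤ := SetLike.coe_injective (by simpa using huniv)
  refine isPreconnected_ncSet_of_grows fun A hA => ⟨∅, ?_⟩
  rw [← htop]
  refine Grows.sup (by simpa using hKLM) (by simpa using hKLc) hMc h1
    (isPreconnected_piece_sdiff hM hq.2) (empty_subset _) (notMem_empty _) h2
    (fun A hA => ?_) (fun _ _ _ => empty_subset _) (by rwa [htop, NonemptyCompacts.coe_top])
  rw [insert_empty_eq]
  exact grows_piece hM hMc hq.2 hA

end Dumbbell

section Main

variable {G : Type*}

theorem isPreconnected_ncSet_iff [TopologicalSpace G] [T2Space G] [CompactSpace G]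
    [ConnectedSpace G] (h : IsFiniteGraph G) : IsPreconnected (ncSet (univ : Set G)) ↔
      IsTangle G ∨ ∃ K L M p q, IsDumbbell (G := G) K L M p q := by
  refine ⟨exists_isDumbbell h, ?_⟩
  rintro (hG | ⟨K, L, M, p, q, hd⟩)
  · have := h.locallyConnectedSpace
    obtain ⟨p⟩ : Nonempty G := inferInstance
    exact isPreconnected_ncSet_of_grows fun A hA => ⟨{p}, grows_top hG hA p⟩
  · exact hd.isPreconnected_ncSet

theorem connectedSpace_NCstar_iff [MetricSpace G] [CompactSpace G] [ConnectedSpace G] :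
    ConnectedSpace (NCstar G) ↔ IsPreconnected (ncSet (univ : Set G)) := by
  have heq : {A : NonemptyCompacts G | IsConnected (A : Set G) ∧ IsPreconnected ((A : Set G)ᶜ)} =
      ncSet (univ : Set G) := by
    ext A
    change _ ∧ _ ↔ _ ∧ _ ∧ _
    simp [IsConnected, A.nonempty, compl_eq_univ_sdiff]
  have hne : (ncSet (univ : Set G)).Nonempty := ⟨⊤, by
    change _ ∧ _ ∧ _
    simp [isPreconnected_univ, isPreconnected_empty]⟩
  rw [← heq] at hne ⊢
  exact isConnected_iff_connectedSpace.symm.trans (and_iff_right hne)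

theorem isArcOrPoint_of_homeomorph [TopologicalSpace G] {J : Set G} (e : unitInterval ≃ₜ J) :
    IsArcOrPoint J (e 0 : G) (e 1 : G) :=
  Or.inr ⟨⟨fun t => e t, by fun_prop⟩, Subtype.val_injective.comp e.injective, rfl, rfl,
    (e.surjective.range_comp Subtype.val).trans Subtype.range_coe⟩

theorem IsArcOrPoint.exists_homeomorph [TopologicalSpace G] [T2Space G] {L : Set G} {p q : G}
    (h : IsArcOrPoint L p q) (hpq : p ≠ q) :
    ∃ e : unitInterval ≃ₜ L, (e 0 : G) = p ∧ (e 1 : G) = q := by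
  rcases h with ⟨-, rfl⟩ | ⟨g, hg, rfl, rfl, rfl⟩
  · exact absurd rfl hpq
  · exact ⟨(g.continuous.isClosedEmbedding hg).isEmbedding.toHomeomorph, rfl, rfl⟩

theorem IsDumbbell.symm [TopologicalSpace G] {K L M : Set G} {p q : G}
    (h : IsDumbbell K L M p q) : IsDumbbell M L K q p := by
  obtain ⟨hK, hM, hL, hKL, hKLM, huniv⟩ := h
  have hp : p ∈ K ∩ L := hKL ▸ mem_singleton p
  have hq : q ∈ (K ∪ L) ∩ M := hKLM ▸ mem_singleton q
  have hML : M ∩ L = {q} := Subset.antisymm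
    (fun x hx => hKLM.subset ⟨Or.inr hx.2, hx.1⟩) (singleton_subset_iff.2 ⟨hq.2, hL.right_mem⟩)
  refine ⟨hM, hK, hL.symm, hML, Subset.antisymm ?_ (singleton_subset_iff.2 ⟨Or.inr hp.2, hp.1⟩),
    by rw [union_comm, union_comm M, ← union_assoc, huniv]⟩
  rintro x ⟨hx | hx, hxK⟩
  · obtain rfl : x = q := hKLM.subset ⟨Or.inl hxK, hx⟩
    exact hKL.subset ⟨hxK, hL.right_mem⟩
  · exact hKL.subset ⟨hxK, hx⟩

theorem _root_.IsTangle.of_eq_univ [TopologicalSpace G] (h : IsFiniteGraph G) {X : Set G}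
    (hX : IsTangle X) (hu : X = univ) : IsTangle G := by
  refine ⟨h, fun p => ?_⟩
  have hp : p ∈ X := hu ▸ mem_univ p
  rw [compl_eq_univ_sdiff, ← hu]
  exact hX.isPreconnected_sdiff hp

theorem exists_isDumbbell_iff [TopologicalSpace G] [T2Space G] [Nontrivial G]
    (h : IsFiniteGraph G) :
    (IsTangle G ∨ ∃ K L M p q, IsDumbbell (G := G) K L M p q) ↔
      (Nonempty (G ≃ₜ unitInterval) ∨
       IsTangle G ∨
       (∃ (K J : Set G) (p : G), IsTangle K ∧ K ∪ J = Set.univ ∧ K ∩ J = {p} ∧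
          ∃ e : unitInterval ≃ₜ J, (e 0 : G) = p) ∨
       (∃ (K M : Set G) (p : G), IsTangle K ∧ IsTangle M ∧ K ∪ M = Set.univ ∧
          K ∩ M = {p}) ∨
       (∃ (K M L : Set G) (p q : G), IsTangle K ∧ IsTangle M ∧ K ∩ M = ∅ ∧
          K ∪ L ∪ M = Set.univ ∧ K ∩ L = {p} ∧ M ∩ L = {q} ∧
          ∃ e : unitInterval ≃ₜ L, (e 0 : G) = p ∧ (e 1 : G) = q)) := by
  constructor
  · rintro (hG | ⟨K, L, M, p, q, hd⟩)
    · exact Or.inr (Or.inl hG)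
    have hd' := hd.symm
    obtain ⟨hK, hM, hL, hKL, hKLM, huniv⟩ := hd
    have hML := hd'.2.2.2.1
    have hp : p ∈ K ∩ L := hKL ▸ mem_singleton p
    have hq : q ∈ M ∩ L := hML ▸ mem_singleton q
    by_cases hpq : p = q
    · subst hpq
      have hL' : L = {p} := by
        rcases hL with ⟨hL, -⟩ | ⟨g, hg, h0, h1, -⟩
        · exact hL
        · exact absurd (hg (h0.trans h1.symm)) zero_ne_one
      have hKL' : K ∪ L = K := union_eq_left.2 (hL' ▸ singleton_subset_iff.2 hp.1)
      rw [hKL'] at hKLM huniv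
      rcases hK with rfl | hK
      · have hMu : M = univ := by rwa [union_eq_right.2 (singleton_subset_iff.2 hq.1)] at huniv
        rcases hM with rfl | hM
        · exact absurd hMu.symm nontrivial_univ.ne_singleton
        · exact Or.inr (Or.inl (hM.of_eq_univ h hMu))
      · rcases hM with rfl | hM
        · rw [union_eq_left.2 (singleton_subset_iff.2 hp.1)] at huniv
          exact Or.inr (Or.inl (hK.of_eq_univ h huniv))
        · exact Or.inr (Or.inr (Or.inr (Or.inl ⟨K, M, p, hK, hM, huniv, hKLM⟩)))
    · obtain ⟨e, he0, he1⟩ := hL.exists_homeomorph hpq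
      rcases hK with rfl | hK
      · rw [union_eq_right.2 (singleton_subset_iff.2 hp.2)] at huniv
        rcases hM with rfl | hM
        · rw [union_eq_left.2 (singleton_subset_iff.2 hq.2)] at huniv
          subst huniv
          exact Or.inl ⟨(e.trans (Homeomorph.Set.univ G)).symm⟩
        · obtain ⟨e', he', -⟩ := hL.symm.exists_homeomorph (Ne.symm hpq)
          exact Or.inr (Or.inr (Or.inl ⟨M, L, q, hM, by rwa [union_comm], hML, e', he'⟩))
      · rcases hM with rfl | hM
        · rw [union_eq_left.2 (singleton_subset_iff.2 (mem_union_right K hq.2))] at huniv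
          exact Or.inr (Or.inr (Or.inl ⟨K, L, p, hK, huniv, hKL, e, he0⟩))
        · refine Or.inr (Or.inr (Or.inr (Or.inr
            ⟨K, M, L, p, q, hK, hM, ?_, huniv, hKL, hML, e, he0, he1⟩)))
          refine eq_empty_of_forall_notMem fun x hx => hpq ?_
          obtain rfl : x = q := hKLM.subset ⟨Or.inl hx.1, hx.2⟩
          exact (hKL.subset ⟨hx.1, hq.2⟩ : x = p).symm
  · rintro (⟨⟨e⟩⟩ | hG | ⟨K, J, p, hK, huniv, hKJ, e, rfl⟩ | ⟨K, M, p, hK, hM, huniv, hKM⟩ |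
      ⟨K, M, L, p, q, hK, hM, hKM, huniv, hKL, hML, e, rfl, rfl⟩)
    · have hL := isArcOrPoint_of_homeomorph (e.symm.trans (Homeomorph.Set.univ G).symm)
      exact Or.inr ⟨_, univ, _, _, _, Or.inl rfl, Or.inl rfl, hL, by simp, by simp, by simp⟩
    · exact Or.inl hG
    · have hL := isArcOrPoint_of_homeomorph e
      have he1 : (e 1 : G) ∈ K ∪ J := huniv ▸ mem_univ _
      exact Or.inr ⟨K, J, _, _, _, Or.inr hK, Or.inl rfl, hL, hKJ,
        inter_eq_right.2 (singleton_subset_iff.2 he1), by simp [huniv]⟩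
    · have hp : p ∈ K ∩ M := hKM ▸ mem_singleton p
      have hKp : K ∪ {p} = K := union_eq_left.2 (singleton_subset_iff.2 hp.1)
      exact Or.inr ⟨K, {p}, M, p, p, Or.inr hK, Or.inr hM, Or.inl ⟨rfl, rfl⟩,
        inter_eq_right.2 (singleton_subset_iff.2 hp.1), by rwa [hKp], by rwa [hKp]⟩
    · refine Or.inr ⟨K, L, M, _, _, Or.inr hK, Or.inr hM, isArcOrPoint_of_homeomorph e, hKL, ?_,
        huniv⟩
      rw [union_inter_distrib_right, hKM, empty_union, inter_comm, hML]

end Main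

end FiniteGraphHyperspace

/-- For a finite graph G, NC*(G) is connected iff G is (A) an arc,
(B) a tangle, (C) a tangle with a sticker, (D) the junction of two tangles, or
(E) two disjoint tangles joined by an arc. -/
theorem stmt9 {G : Type*} [MetricSpace G] [CompactSpace G] [ConnectedSpace G] [Nontrivial G]
    (hfg : IsFiniteGraph G) :
    ConnectedSpace (NCstar G) ↔
      (Nonempty (G ≃ₜ unitInterval) ∨
       IsTangle G ∨
       (∃ (K J : Set G) (p : G), IsTangle K ∧ K ∪ J = Set.univ ∧ K ∩ J = {p} ∧
          ∃ e : unitInterval ≃ₜ J, (e 0 : G) = p) ∨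
       (∃ (K M : Set G) (p : G), IsTangle K ∧ IsTangle M ∧ K ∪ M = Set.univ ∧
          K ∩ M = {p}) ∨
       (∃ (K M L : Set G) (p q : G), IsTangle K ∧ IsTangle M ∧ K ∩ M = ∅ ∧
          K ∪ L ∪ M = Set.univ ∧ K ∩ L = {p} ∧ M ∩ L = {q} ∧
          ∃ e : unitInterval ≃ₜ L, (e 0 : G) = p ∧ (e 1 : G) = q)) := by
  exact FiniteGraphHyperspace.connectedSpace_NCstar_iff.trans
    ((FiniteGraphHyperspace.isPreconnected_ncSet_iff hfg).trans
      (FiniteGraphHyperspace.exists_isDumbbell_iff hfg))
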